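/- arXiv:2603.16135 — 2 statements merged into one kernel-verified Lean document; each statement's English description precedes it below -/
import Mathlib

section
/- There exists a universal numeric constant c > 0 such that for every n ≥ 1, every orthotope R in ℝⁿ, and all integers k ≥ l ≥ 1, one has μ_k(R) ≤ c · n³ · (k/l)² · μ_l(R). -/
open MeasureTheory

/-- The `k`-th Neumann eigenvalue of the Laplacian on `Ω ⊆ ℝⁿ`, defined via the
Courant–Fischer min-max principle: the infimum over `(k+1)`-dimensional spaces `V`
of test functions (smooth functions, distinguished by their restrictions to `Ω`)
of the supremum of the Rayleigh quotient `∫_Ω ‖∇f‖² / ∫_Ω f²` over nonzero `f ∈ V`. -/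
noncomputable def neumannEigenvalue (n : ℕ) (k : ℕ)
    (Ω : Set (EuclideanSpace ℝ (Fin n))) : ℝ :=
  ⨅ V : {V : Submodule ℝ (EuclideanSpace ℝ (Fin n) → ℝ) //
      Module.finrank ℝ V = k + 1 ∧ (∀ f ∈ V, ContDiff ℝ (⊤ : ℕ∞) f) ∧
      ∀ f ∈ V, (∀ x ∈ Ω, f x = 0) → f = 0},
    ⨆ f : {f : EuclideanSpace ℝ (Fin n) → ℝ // f ∈ V.1 ∧ f ≠ 0},
      (∫ x in Ω, ‖fderiv ℝ f.1 x‖ ^ 2) / ∫ x in Ω, (f.1 x) ^ 2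

/-- `Ω` is an orthotope in `ℝⁿ`: up to a rigid motion, it is a product
`∏ i, [-a i, a i]` with all `a i > 0`. -/
def IsOrthotope (n : ℕ) (Ω : Set (EuclideanSpace ℝ (Fin n))) : Prop :=
  ∃ (T : EuclideanSpace ℝ (Fin n) ≃ᵢ EuclideanSpace ℝ (Fin n)) (a : Fin n → ℝ),
    (∀ i, 0 < a i) ∧ Ω = T '' {x : EuclideanSpace ℝ (Fin n) | ∀ i, |x i| ≤ a i}


namespace OUB

/-- bounded continuous real functions -/
def BC {X : Type*} [TopologicalSpace X] (f : X → ℝ) : Prop :=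
  Continuous f ∧ ∃ C, ∀ x, |f x| ≤ C

section BCsec
variable {X Y : Type*} [TopologicalSpace X] [TopologicalSpace Y]

lemma BC.mul {f g : X → ℝ} (hf : BC f) (hg : BC g) : BC (fun x => f x * g x) := by
  obtain ⟨hf, C, hC⟩ := hf
  obtain ⟨hg, D, hD⟩ := hg
  refine ⟨hf.mul hg, C * D, fun x => ?_⟩
  rw [abs_mul]
  exact mul_le_mul (hC x) (hD x) (abs_nonneg _) ((abs_nonneg _).trans (hC x))

lemma BC.sub {f g : X → ℝ} (hf : BC f) (hg : BC g) : BC (fun x => f x - g x) := by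
  obtain ⟨hf, C, hC⟩ := hf
  obtain ⟨hg, D, hD⟩ := hg
  refine ⟨hf.sub hg, C + D, fun x => (abs_sub _ _).trans (add_le_add (hC x) (hD x))⟩

lemma BC.const (c : ℝ) : BC (fun _ : X => c) := ⟨continuous_const, |c|, fun _ => le_rfl⟩

lemma BC.sq {f : X → ℝ} (hf : BC f) : BC (fun x => (f x) ^ 2) := by
  simpa [_root_.sq] using hf.mul hf

lemma BC.comp {f : X → ℝ} (hf : BC f) {g : Y → X} (hg : Continuous g) : BC (fun y => f (g y)) :=
  ⟨hf.1.comp hg, hf.2.imp fun _ h y => h (g y)⟩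

lemma BC.integrable [MeasurableSpace X] [OpensMeasurableSpace X] [SecondCountableTopology X]
    {f : X → ℝ} (hf : BC f) (μ : Measure X) [IsFiniteMeasure μ] : Integrable f μ := by
  obtain ⟨hf, C, hC⟩ := hf
  exact Integrable.of_bound hf.aestronglyMeasurable C (Filter.Eventually.of_forall hC)

lemma BC.integral [MeasurableSpace X] [OpensMeasurableSpace X] [SecondCountableTopology X]
    [FirstCountableTopology Y]
    {f : Y → X → ℝ} (hf : BC (fun p : Y × X => f p.1 p.2)) (μ : Measure X) [IsFiniteMeasure μ] :
    BC (fun y => ∫ x, f y x ∂μ) := by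
  obtain ⟨hf, C, hC⟩ := hf
  refine ⟨?_, C * μ.real Set.univ, fun y => ?_⟩
  · refine continuous_of_dominated (bound := fun _ => C) (fun y => ?_) (fun y => ?_) ?_ ?_
    · exact (hf.comp (Continuous.prodMk_right y)).aestronglyMeasurable
    · exact Filter.Eventually.of_forall fun x => hC (y, x)
    · exact integrable_const _
    · exact Filter.Eventually.of_forall fun x => hf.comp (Continuous.prodMk_left x)
  · exact norm_integral_le_of_norm_le_const (f := fun x => f y x)
      (Filter.Eventually.of_forall fun x => hC (y, x))

end BCsec

lemma quad_integral {X : Type*} [MeasurableSpace X]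
    (μ : Measure X) [IsFiniteMeasure μ] {f : X → ℝ} (hi : Integrable f μ)
    (hi2 : Integrable (fun x => f x ^ 2) μ) (a b c : ℝ) :
    ∫ x, (a * f x ^ 2 + b * f x + c) ∂μ
      = a * ∫ x, f x ^ 2 ∂μ + b * ∫ x, f x ∂μ + c * μ.real Set.univ := by
  rw [integral_add (f := fun x => a * f x ^ 2 + b * f x)
      ((hi2.const_mul _).add (hi.const_mul _)) (integrable_const _),
      integral_add (hi2.const_mul _) (hi.const_mul _), integral_const_mul, integral_const_mul]
  simp
  ring

/-- variance identity -/
lemma var_identity {X : Type*} [TopologicalSpace X] [MeasurableSpace X] [OpensMeasurableSpace X]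
    [SecondCountableTopology X] (μ : Measure X) [IsFiniteMeasure μ] {f : X → ℝ} (hf : BC f) :
    ∫ x, ∫ y, (f x - f y) ^ 2 ∂μ ∂μ
      = 2 * (μ.real Set.univ * ∫ x, f x ^ 2 ∂μ - (∫ x, f x ∂μ) ^ 2) := by
  have hi := hf.integrable μ
  have hi2 := hf.sq.integrable μ
  have h1 : ∀ x, ∫ y, (f x - f y) ^ 2 ∂μ
      = μ.real Set.univ * f x ^ 2 - 2 * (∫ y, f y ∂μ) * f x + ∫ y, f y ^ 2 ∂μ := by
    intro x
    have : ∀ y, (f x - f y) ^ 2 = 1 * f y ^ 2 + (- 2 * f x) * f y + f x ^ 2 := fun y => by ring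
    simp_rw [this]
    rw [quad_integral μ hi hi2]
    ring
  have h2 : ∀ x, ∫ y, (f x - f y) ^ 2 ∂μ
      = μ.real Set.univ * f x ^ 2 + (- 2 * (∫ y, f y ∂μ)) * f x + ∫ y, f y ^ 2 ∂μ := by
    intro x
    rw [h1]; ring
  simp_rw [h2]
  rw [quad_integral μ hi hi2]
  ring

lemma cs_ineq {X : Type*} [MeasurableSpace X]
    (μ : Measure X) [IsFiniteMeasure μ] {f : X → ℝ} (hi : Integrable f μ)
    (hi2 : Integrable (fun x => f x ^ 2) μ) :
    (∫ x, f x ∂μ) ^ 2 ≤ μ.real Set.univ * ∫ x, f x ^ 2 ∂μ := by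
  set m := μ.real Set.univ with hm
  set I := ∫ x, f x ∂μ with hI
  have h : 0 ≤ ∫ x, (m * f x - I) ^ 2 ∂μ := integral_nonneg fun x => sq_nonneg _
  have e : ∀ x, (m * f x - I) ^ 2 = m ^ 2 * f x ^ 2 + (- 2 * m * I) * f x + I ^ 2 := fun x => by ring
  simp_rw [e] at h
  rw [quad_integral μ hi hi2, ← hm, ← hI] at h
  have hm0 : 0 ≤ m := measureReal_nonneg
  rcases hm0.eq_or_lt with h0 | h0
  · have : μ = 0 := by
      rw [← Measure.measure_univ_eq_zero]
      exact (measureReal_eq_zero_iff).1 (by rw [← hm, ← h0])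
    have : I = 0 := by rw [hI, this]; simp
    rw [this, ← h0]; simp
  · have : 0 ≤ m * (m * ∫ x, f x ^ 2 ∂μ - I ^ 2) := by nlinarith
    have := nonneg_of_mul_nonneg_right this h0
    linarith

lemma pi_fubini {n : ℕ} (i : Fin (n + 1)) (μ : Fin (n + 1) → Measure ℝ)
    [∀ i, IsFiniteMeasure (μ i)] {f : (Fin (n + 1) → ℝ) → ℝ} (hf : BC f) :
    ∫ x, f x ∂(Measure.pi μ)
      = ∫ y, ∫ t, f (i.insertNth (α := fun _ => ℝ) t y) ∂(μ i)
          ∂(Measure.pi fun j => μ (i.succAbove j)) := by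
  have h := (measurePreserving_piFinSuccAbove μ i).symm
  rw [← h.integral_comp (MeasurableEquiv.measurableEmbedding _)]
  have hc : Continuous fun p : ℝ × (Fin n → ℝ) => i.insertNth (α := fun _ => ℝ) p.1 p.2 := by
    fun_prop
  exact integral_prod_symm _ ((hf.comp hc).integrable _)

lemma upd_fubini {n : ℕ} (i : Fin n) (μ : Fin n → Measure ℝ)
    [∀ i, IsFiniteMeasure (μ i)] {f : (Fin n → ℝ) → ℝ} (hf : BC f) :
    ∫ x, ∫ t, f (Function.update x i t) ∂(μ i) ∂(Measure.pi μ)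
      = (μ i).real Set.univ * ∫ x, f x ∂(Measure.pi μ) := by
  obtain _ | n := n
  · exact i.elim0
  have hb : BC (fun p : (Fin (n+1) → ℝ) × ℝ => f (Function.update p.1 i p.2)) :=
    hf.comp (by fun_prop)
  rw [pi_fubini i μ (BC.integral (f := fun x t => f (Function.update x i t)) hb (μ i)),
    pi_fubini i μ hf, ← integral_const_mul]
  simp

lemma efron_stein : ∀ (n : ℕ) (μ : Fin n → Measure ℝ) [∀ i, IsFiniteMeasure (μ i)]
    (_ : ∀ i, 0 < (μ i).real Set.univ) (f : (Fin n → ℝ) → ℝ) (_ : BC f)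
    (_ : ∫ x, f x ∂(Measure.pi μ) = 0),
    ∫ x, f x ^ 2 ∂(Measure.pi μ) ≤ ∑ i, 1 / (2 * (μ i).real Set.univ) *
      ∫ x, ∫ t, (f x - f (Function.update x i t)) ^ 2 ∂(μ i) ∂(Measure.pi μ) := by
  intro n
  induction n with
  | zero =>
    intro μ _ _ f _ h0
    rw [Measure.pi_of_empty μ, integral_dirac] at h0
    rw [Measure.pi_of_empty μ, integral_dirac, h0]
    simp
  | succ n ih =>
    intro μ _ hpos f hf h0
    set m := (μ 0).real Set.univ with hm
    have hm0 : 0 < m := hpos 0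
    set ν : Fin n → Measure ℝ := fun j => μ j.succ with hν
    have fub : ∀ {F : (Fin (n+1) → ℝ) → ℝ}, BC F → ∫ x, F x ∂(Measure.pi μ)
        = ∫ y, ∫ t, F (Fin.cons t y) ∂(μ 0) ∂(Measure.pi ν) := by
      intro F hF
      have := pi_fubini 0 μ hF
      simpa using this
    have hcons : Continuous fun p : (Fin n → ℝ) × ℝ => (Fin.cons p.2 p.1 : Fin (n+1) → ℝ) := by
      have := Continuous.finInsertNth (A := fun _ => ℝ) (0 : Fin (n+1)) (f := fun p : (Fin n → ℝ) × ℝ => p.2)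
        (g := fun p => p.1) continuous_snd continuous_fst
      simpa using this
    have hfc : BC (fun p : (Fin n → ℝ) × ℝ => f (Fin.cons p.2 p.1)) := hf.comp hcons
    have hfy : ∀ y : Fin n → ℝ, BC (fun t : ℝ => f (Fin.cons t y)) := fun y =>
      hfc.comp (g := fun t => (y, t)) (by fun_prop)
    set g : (Fin n → ℝ) → ℝ := fun y => m⁻¹ * ∫ t, f (Fin.cons t y) ∂(μ 0) with hg
    have hgI : BC (fun y : Fin n → ℝ => ∫ t, f (Fin.cons t y) ∂(μ 0)) :=
      BC.integral (f := fun (y : Fin n → ℝ) t => f (Fin.cons t y)) hfc (μ 0)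
    have hgB : BC g := (BC.const _).mul hgI
    have hg0 : ∫ y, g y ∂(Measure.pi ν) = 0 := by
      rw [hg, integral_const_mul, ← fub hf, h0, mul_zero]
    have IH := ih ν (fun i => hpos _) g hgB hg0
    have hD : BC (fun p : (Fin n → ℝ) × ℝ => ∫ u, (f (Fin.cons p.2 p.1) - f (Fin.cons u p.1)) ^ 2 ∂(μ 0)) := by
      refine BC.integral (f := fun (p : (Fin n → ℝ) × ℝ) u => (f (Fin.cons p.2 p.1) - f (Fin.cons u p.1)) ^ 2) ?_ (μ 0)
      refine ((hfc.comp continuous_fst).sub (hfc.comp (g := fun q : ((Fin n → ℝ) × ℝ) × ℝ => (q.1.1, q.2)) ?_)).sq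
      fun_prop
    have hD' : BC (fun y : Fin n → ℝ => ∫ t, ∫ u, (f (Fin.cons t y) - f (Fin.cons u y)) ^ 2 ∂(μ 0) ∂(μ 0)) := 
      BC.integral (f := fun (y : Fin n → ℝ) t => ∫ u, (f (Fin.cons t y) - f (Fin.cons u y)) ^ 2 ∂(μ 0)) hD (μ 0)
    have hup : ∀ i : Fin (n+1), BC (fun x : Fin (n+1) → ℝ =>
        ∫ t, (f x - f (Function.update x i t)) ^ 2 ∂(μ i)) := by
      intro i
      refine BC.integral (f := fun (x : Fin (n+1) → ℝ) t => (f x - f (Function.update x i t)) ^ 2) ?_ (μ i)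
      exact ((hf.comp continuous_fst).sub (hf.comp (g := fun p : (Fin (n+1) → ℝ) × ℝ => Function.update p.1 i p.2)
        (by fun_prop))).sq
    -- decomposition
    have hdec : ∫ x, f x ^ 2 ∂(Measure.pi μ) = 1 / (2 * m) *
        ∫ x, ∫ t, (f x - f (Function.update x 0 t)) ^ 2 ∂(μ 0) ∂(Measure.pi μ)
        + m * ∫ y, g y ^ 2 ∂(Measure.pi ν) := by
      rw [fub hf.sq, fub (hup 0), ← integral_const_mul, ← integral_const_mul, ← integral_add]
      · refine integral_congr_ae (Filter.Eventually.of_forall fun y => ?_)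
        simp only [Fin.update_cons_zero]
        rw [var_identity (μ 0) (hfy y), hg, ← hm]
        field_simp
        ring
      · simp only [Fin.update_cons_zero]
        exact (hD'.integrable _).const_mul _
      · exact (hgB.sq.integrable _).const_mul _
    rw [hdec, Fin.sum_univ_succ]
    refine add_le_add le_rfl ?_
    refine (mul_le_mul_of_nonneg_left IH hm0.le).trans ?_
    rw [Finset.mul_sum]
    refine Finset.sum_le_sum fun i _ => ?_
    rw [fub (hup i.succ), mul_left_comm]
    refine mul_le_mul_of_nonneg_left ?_ (by have := hpos i.succ; positivity)
    rw [← integral_const_mul]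
    -- pointwise
    have hT : BC (fun q : ((Fin n → ℝ) × ℝ) × ℝ =>
        (f (Fin.cons q.2 q.1.1) - f (Fin.cons q.2 (Function.update q.1.1 i q.1.2))) ^ 2) := by
      refine ((hfc.comp (g := fun q : ((Fin n → ℝ) × ℝ) × ℝ => (q.1.1, q.2)) (by fun_prop)).sub
        (hfc.comp (g := fun q : ((Fin n → ℝ) × ℝ) × ℝ => (Function.update q.1.1 i q.1.2, q.2)) (by fun_prop))).sq
    have hT1 : BC (fun p : (Fin n → ℝ) × ℝ => ∫ t, 
        (f (Fin.cons t p.1) - f (Fin.cons t (Function.update p.1 i p.2))) ^ 2 ∂(μ 0)) :=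
      BC.integral (f := fun (p : (Fin n → ℝ) × ℝ) t =>
        (f (Fin.cons t p.1) - f (Fin.cons t (Function.update p.1 i p.2))) ^ 2) hT (μ 0)
    have hgu : BC (fun p : (Fin n → ℝ) × ℝ => (g p.1 - g (Function.update p.1 i p.2)) ^ 2) :=
      ((hgB.comp continuous_fst).sub (hgB.comp (g := fun p : (Fin n → ℝ) × ℝ => Function.update p.1 i p.2)
        (by fun_prop))).sq
    have hsw : ∀ y : Fin n → ℝ, ∫ t, ∫ u, (f (Fin.cons t y) - f (Function.update (Fin.cons t y) i.succ u)) ^ 2 ∂(μ i.succ) ∂(μ 0)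
       = ∫ u, ∫ t, (f (Fin.cons t y) - f (Fin.cons t (Function.update y i u))) ^ 2 ∂(μ 0) ∂(ν i) := by
      intro y
      simp_rw [← Fin.cons_update]
      rw [integral_integral_swap]
      refine BC.integrable ?_ _
      exact hT.comp (g := fun r : ℝ × ℝ => ((y, r.2), r.1)) (by fun_prop)
    simp_rw [hsw]
    refine integral_mono ?_ ?_ fun y => ?_
    · exact ((BC.integral (f := fun (y : Fin n → ℝ) u => (g y - g (Function.update y i u)) ^ 2) hgu (ν i)).integrable _).const_mul _
    · exact (BC.integral (f := fun (y : Fin n → ℝ) u => ∫ t, 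
        (f (Fin.cons t y) - f (Fin.cons t (Function.update y i u))) ^ 2 ∂(μ 0)) hT1 (ν i)).integrable _
    · simp only
      rw [← integral_const_mul]
      refine integral_mono ?_ ?_ fun u => ?_
      · exact ((hgu.comp (g := fun u => (y, u)) (by fun_prop)).integrable _).const_mul _
      · exact (hT1.comp (g := fun u => (y, u)) (by fun_prop)).integrable _
      · simp only
        have hs := (hfy y).sub (hfy (Function.update y i u))
        have := cs_ineq (μ 0) (hs.integrable _) (hs.sq.integrable _)
        rw [integral_sub ((hfy y).integrable _) ((hfy _).integrable _), ← hm] at this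
        rw [hg]
        simp only
        rw [← mul_sub, mul_pow, _root_.sq m⁻¹]
        have e : m * (m⁻¹ * m⁻¹ * (∫ t, f (Fin.cons t y) ∂(μ 0) - ∫ t, f (Fin.cons t (Function.update y i u)) ∂(μ 0)) ^ 2)
          = m⁻¹ * (∫ t, f (Fin.cons t y) ∂(μ 0) - ∫ t, f (Fin.cons t (Function.update y i u)) ∂(μ 0)) ^ 2 := by
          field_simp
        rw [e, inv_mul_le_iff₀ hm0]
        exact this

end OUB


namespace OUB

lemma hasDerivAt_update_comp {n : ℕ} {f : (Fin n → ℝ) → ℝ} (hf : ContDiff ℝ 1 f)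
    (x : Fin n → ℝ) (i : Fin n) (u : ℝ) :
    HasDerivAt (fun t => f (Function.update x i t))
      (fderiv ℝ f (Function.update x i u) (Pi.single i 1)) u := by
  have h1 := (hf.differentiable (by norm_num) (Function.update x i u)).hasFDerivAt
  exact h1.comp_hasDerivAt u (hasDerivAt_update x i u)

lemma one_dim {p q : ℝ} {h h' : ℝ → ℝ} (hh : ∀ u, HasDerivAt h (h' u) u)
    (hc : Continuous h') {a b : ℝ} (ha : a ∈ Set.Ioc p q) (hb : b ∈ Set.Ioc p q) :
    (h a - h b) ^ 2 ≤ (q - p) * ∫ u in Set.Ioc p q, h' u ^ 2 := by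
  have hpq : p ≤ q := (ha.1.trans_le ha.2).le
  have e : ∫ u in b..a, h' u = h a - h b :=
    intervalIntegral.integral_eq_sub_of_hasDerivAt (fun u _ => hh u) (hc.intervalIntegrable _ _)
  have hInt : IntegrableOn (fun u => |h' u|) (Set.Ioc p q) :=
    (hc.abs.integrableOn_Icc).mono_set Set.Ioc_subset_Icc_self
  have hInt2 : IntegrableOn (fun u => |h' u| ^ 2) (Set.Ioc p q) :=
    ((hc.abs.pow 2).integrableOn_Icc).mono_set Set.Ioc_subset_Icc_self
  have h1 : |h a - h b| ≤ ∫ u in Set.Ioc p q, |h' u| := by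
    rw [← e]
    refine (intervalIntegral.norm_integral_le_integral_norm_uIoc (f := h') (μ := volume) (a := b) (b := a)).trans ?_
    refine setIntegral_mono_set hInt (Filter.Eventually.of_forall fun u => abs_nonneg _) ?_
    refine HasSubset.Subset.eventuallyLE ?_
    intro u hu
    rw [Set.mem_uIoc] at hu
    simp only [Set.mem_Ioc] at *
    rcases hu with hu | hu <;> constructor <;> linarith
  have h2 := cs_ineq (volume.restrict (Set.Ioc p q)) hInt hInt2
  have h3 : (volume.restrict (Set.Ioc p q)).real Set.univ = q - p := by
    simp [Measure.real, hpq]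
  rw [h3] at h2
  simp only [sq_abs] at h2
  refine le_trans ?_ h2
  rw [← sq_abs (h a - h b)]
  exact pow_le_pow_left₀ (abs_nonneg _) h1 2

lemma cell_poincare {n : ℕ} (p q : Fin n → ℝ) (hpq : ∀ i, p i < q i) {s : ℝ}
    (hs : ∀ i, q i - p i ≤ s) {f : (Fin n → ℝ) → ℝ} (hf : ContDiff ℝ 1 f)
    (h0 : ∫ x in Set.univ.pi (fun i => Set.Ioc (p i) (q i)), f x = 0) :
    ∫ x in Set.univ.pi (fun i => Set.Ioc (p i) (q i)), f x ^ 2 ≤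
      s ^ 2 / 2 * ∑ i, ∫ x in Set.univ.pi (fun i => Set.Ioc (p i) (q i)),
        (fderiv ℝ f x (Pi.single i 1)) ^ 2 := by
  set B := Set.univ.pi (fun i => Set.Ioc (p i) (q i)) with hB
  have hBm : MeasurableSet B := MeasurableSet.univ_pi fun i => measurableSet_Ioc
  set μ : Fin n → Measure ℝ := fun i => volume.restrict (Set.Ioc (p i) (q i)) with hμ
  have hpi : Measure.pi μ = volume.restrict B := by
    rw [hμ, hB, volume_pi, Measure.restrict_pi_pi]
  have hmass : ∀ i, (μ i).real Set.univ = q i - p i := fun i => by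
    simp [hμ, Measure.real, (hpq i).le]
  set cl : (Fin n → ℝ) → (Fin n → ℝ) := fun x i => max (p i) (min (q i) (x i)) with hcl
  have hclc : Continuous cl := by rw [hcl]; fun_prop
  have hclm : ∀ x, cl x ∈ Set.Icc p q := fun x =>
    ⟨fun i => le_max_left _ _, fun i => max_le (hpq i).le (min_le_left _ _)⟩
  have hcle : ∀ x ∈ B, cl x = x := by
    intro x hx
    funext i
    have := hx i (Set.mem_univ i)
    simp only [hcl]
    rw [min_eq_right this.2, max_eq_right this.1.le]
  have hBC : ∀ {g : (Fin n → ℝ) → ℝ}, Continuous g → BC (fun x => g (cl x)) := by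
    intro g hg
    refine ⟨hg.comp hclc, ?_⟩
    obtain ⟨C, hC⟩ := (isCompact_Icc (a := p) (b := q)).exists_bound_of_continuousOn hg.continuousOn
    exact ⟨C, fun x => hC _ (hclm x)⟩
  have hDc : ∀ i, Continuous fun x => fderiv ℝ f x (Pi.single i 1) := fun i =>
    (hf.continuous_fderiv (by norm_num)).clm_apply continuous_const
  have hfb := hBC hf.continuous
  have hDb : ∀ i, BC (fun x => (fderiv ℝ f (cl x) (Pi.single i 1)) ^ 2) := fun i =>
    (hBC (hDc i)).sq
  have tr : ∀ g : (Fin n → ℝ) → ℝ, ∫ x, g (cl x) ∂(Measure.pi μ) = ∫ x in B, g x := by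
    intro g
    rw [hpi]
    exact setIntegral_congr_fun hBm fun x hx => by simp only [hcle x hx]
  have ES := efron_stein n μ (fun i => by rw [hmass]; linarith [hpq i]) _ hfb (by rw [tr f, h0])
  rw [tr (fun x => f x ^ 2)] at ES
  refine ES.trans ?_
  rw [Finset.mul_sum]
  refine Finset.sum_le_sum fun i _ => ?_
  rw [hmass, ← tr (fun x => (fderiv ℝ f x (Pi.single i 1)) ^ 2)]
  set ℓ := q i - p i with hℓ
  have hℓ0 : 0 < ℓ := by linarith [hpq i]
  have key : ∫ x, ∫ t, (f (cl x) - f (cl (Function.update x i t))) ^ 2 ∂(μ i) ∂(Measure.pi μ)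
      ≤ ℓ ^ 3 * ∫ x, (fderiv ℝ f (cl x) (Pi.single i 1)) ^ 2 ∂(Measure.pi μ) := by
    have e := upd_fubini i μ (hDb i)
    rw [hmass] at e
    have e2 : ℓ ^ 3 * ∫ x, (fderiv ℝ f (cl x) (Pi.single i 1)) ^ 2 ∂(Measure.pi μ)
      = ∫ x, ℓ ^ 2 * ∫ t, (fderiv ℝ f (cl (Function.update x i t)) (Pi.single i 1)) ^ 2 ∂(μ i) ∂(Measure.pi μ) := by
      rw [integral_const_mul, e]; ring
    rw [e2]
    refine integral_mono_ae ?_ ?_ ?_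
    · refine (BC.integral (f := fun x t => (f (cl x) - f (cl (Function.update x i t))) ^ 2) ?_ (μ i)).integrable _
      exact ((hfb.comp continuous_fst).sub (hfb.comp (g := fun p : (Fin n → ℝ) × ℝ => Function.update p.1 i p.2)
        (by fun_prop))).sq
    · refine ((BC.integral (f := fun x t => (fderiv ℝ f (cl (Function.update x i t)) (Pi.single i 1)) ^ 2) ?_ (μ i)).integrable _).const_mul _
      exact ((hDb i).comp (g := fun p : (Fin n → ℝ) × ℝ => Function.update p.1 i p.2)
        (by fun_prop))
    · rw [hpi]
      filter_upwards [ae_restrict_mem hBm] with x hx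
      have hupd : ∀ t ∈ Set.Ioc (p i) (q i), Function.update x i t ∈ B := by
        intro t ht j _
        by_cases hj : j = i
        · subst hj; simpa using ht
        · simpa [hj] using hx j (Set.mem_univ j)
      have hI : ∫ t, (fderiv ℝ f (cl (Function.update x i t)) (Pi.single i 1)) ^ 2 ∂(μ i)
          = ∫ t in Set.Ioc (p i) (q i), (fderiv ℝ f (Function.update x i t) (Pi.single i 1)) ^ 2 :=
        setIntegral_congr_fun measurableSet_Ioc fun t ht => by simp only [hcle _ (hupd t ht)]
      have hI2 : ∫ t, (f (cl x) - f (cl (Function.update x i t))) ^ 2 ∂(μ i)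
          = ∫ t in Set.Ioc (p i) (q i), (f x - f (Function.update x i t)) ^ 2 :=
        setIntegral_congr_fun measurableSet_Ioc fun t ht => by simp only [hcle _ (hupd t ht), hcle _ hx]
      rw [hI, hI2]
      set K := ∫ t in Set.Ioc (p i) (q i), (fderiv ℝ f (Function.update x i t) (Pi.single i 1)) ^ 2
      have hc : Continuous fun t => f (Function.update x i t) :=
        hf.continuous.comp (by fun_prop)
      have : ∫ t in Set.Ioc (p i) (q i), (f x - f (Function.update x i t)) ^ 2
          ≤ ∫ t in Set.Ioc (p i) (q i), ℓ * K := by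
        refine setIntegral_mono_on ?_ ?_ measurableSet_Ioc fun t ht => ?_
        · exact (((continuous_const.sub hc).pow 2).integrableOn_Icc).mono_set Set.Ioc_subset_Icc_self
        · exact integrable_const _
        · have := one_dim (hasDerivAt_update_comp hf x i)
            ((hDc i).comp (g := fun x => fderiv ℝ f x (Pi.single i 1)) (f := fun t => Function.update x i t) (by fun_prop))
            (hx i (Set.mem_univ i)) ht
          simpa using this
      refine this.trans (le_of_eq ?_)
      rw [setIntegral_const, smul_eq_mul]
      simp [Measure.real, (hpq i).le]
      ring
  have hK : 0 ≤ ∫ x, (fderiv ℝ f (cl x) (Pi.single i 1)) ^ 2 ∂(Measure.pi μ) :=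
    integral_nonneg fun x => sq_nonneg _
  calc _ ≤ 1 / (2 * ℓ) * (ℓ ^ 3 * ∫ x, (fderiv ℝ f (cl x) (Pi.single i 1)) ^ 2 ∂(Measure.pi μ)) := by
        gcongr
    _ = ℓ ^ 2 / 2 * ∫ x, (fderiv ℝ f (cl x) (Pi.single i 1)) ^ 2 ∂(Measure.pi μ) := by
        field_simp
    _ ≤ _ := by
        gcongr
        exact hs i

end OUB


namespace OUB

/-- a cell of the uniform grid -/
def cell {n : ℕ} (L : Fin n → ℝ) (m : Fin n → ℕ) (J : (i : Fin n) → Fin (m i)) : Set (Fin n → ℝ) :=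
  Set.univ.pi fun i => Set.Ioc ((J i : ℕ) * (L i / m i)) (((J i : ℕ) + 1) * (L i / m i))

lemma cell_measurable {n : ℕ} (L : Fin n → ℝ) (m : Fin n → ℕ) (J : (i : Fin n) → Fin (m i)) :
    MeasurableSet (cell L m J) := MeasurableSet.univ_pi fun _ => measurableSet_Ioc

lemma iUnion_cell {n : ℕ} (L : Fin n → ℝ) (hL : ∀ i, 0 < L i) (m : Fin n → ℕ) (hm : ∀ i, 0 < m i) :
    ⋃ J, cell L m J = Set.univ.pi fun i => Set.Ioc 0 (L i) := by
  have hℓ : ∀ i, 0 < L i / m i := fun i => div_pos (hL i) (by exact_mod_cast hm i)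
  ext x
  simp only [Set.mem_iUnion, cell, Set.mem_pi, Set.mem_univ, true_imp_iff, Set.mem_Ioc]
  constructor
  · rintro ⟨J, hJ⟩ i
    have h1 := hJ i
    have h2 : ((J i : ℕ) : ℝ) + 1 ≤ m i := by exact_mod_cast (J i).2
    refine ⟨lt_of_le_of_lt (by have := hℓ i; positivity) h1.1, h1.2.trans ?_⟩
    calc _ ≤ (m i : ℝ) * (L i / m i) := mul_le_mul_of_nonneg_right h2 (hℓ i).le
      _ = L i := by
        have : (m i : ℝ) ≠ 0 := by exact_mod_cast (hm i).ne'
        field_simp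
  · intro hx
    have hc : ∀ i, 0 < ⌈x i / (L i / m i)⌉₊ := fun i => Nat.ceil_pos.2 (div_pos (hx i).1 (hℓ i))
    have hc2 : ∀ i, ⌈x i / (L i / m i)⌉₊ ≤ m i := fun i => by
      rw [Nat.ceil_le, div_le_iff₀ (hℓ i)]
      have : (m i : ℝ) ≠ 0 := by exact_mod_cast (hm i).ne'
      have : (m i : ℝ) * (L i / m i) = L i := by field_simp
      rw [this]
      exact (hx i).2
    refine ⟨fun i => ⟨⌈x i / (L i / m i)⌉₊ - 1, by have := hc i; have := hc2 i; omega⟩, fun i => ?_⟩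
    have e : ((⌈x i / (L i / m i)⌉₊ - 1 : ℕ) : ℝ) = (⌈x i / (L i / m i)⌉₊ : ℝ) - 1 := by
      have := hc i
      push_cast [Nat.cast_sub (Nat.succ_le_of_lt this)]
      simp
    simp only [e]
    rw [← lt_div_iff₀ (hℓ i), sub_add_cancel, ← div_le_iff₀ (hℓ i)]
    refine ⟨?_, Nat.le_ceil _⟩
    have := Nat.ceil_lt_add_one (div_pos (hx i).1 (hℓ i)).le
    linarith

lemma cell_disjoint {n : ℕ} (L : Fin n → ℝ) (hL : ∀ i, 0 < L i) (m : Fin n → ℕ) (hm : ∀ i, 0 < m i) :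
    Pairwise fun J K => Disjoint (cell L m J) (cell L m K) := by
  have hℓ : ∀ i, 0 < L i / m i := fun i => div_pos (hL i) (by exact_mod_cast hm i)
  intro J K hJK
  rw [Set.disjoint_left]
  intro x hJ hK
  refine hJK (funext fun i => ?_)
  have h1 := hJ i (Set.mem_univ i)
  have h2 := hK i (Set.mem_univ i)
  simp only [Set.mem_Ioc] at h1 h2
  have a := lt_of_mul_lt_mul_right (h1.1.trans_le h2.2) (hℓ i).le
  have b := lt_of_mul_lt_mul_right (h2.1.trans_le h1.2) (hℓ i).le
  have a' : (J i : ℕ) < (K i : ℕ) + 1 := by exact_mod_cast a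
  have b' : (K i : ℕ) < (J i : ℕ) + 1 := by exact_mod_cast b
  apply Fin.ext
  omega

lemma pi_Ioc_ae (n : ℕ) (L : Fin n → ℝ) :
    (Set.univ.pi fun i => Set.Ioc 0 (L i)) =ᵐ[volume] Set.Icc (0 : Fin n → ℝ) L :=
  Measure.univ_pi_Ioc_ae_eq_Icc

lemma box_poincare {n : ℕ} (L : Fin n → ℝ) (hL : ∀ i, 0 < L i) (m : Fin n → ℕ) (hm : ∀ i, 0 < m i)
    {s : ℝ} (hs : ∀ i, L i / m i ≤ s) {f : (Fin n → ℝ) → ℝ} (hf : ContDiff ℝ 1 f)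
    (h0 : ∀ J, ∫ x in cell L m J, f x = 0) :
    ∫ x in Set.Icc 0 L, f x ^ 2 ≤
      s ^ 2 / 2 * ∑ i, ∫ x in Set.Icc 0 L, (fderiv ℝ f x (Pi.single i 1)) ^ 2 := by
  have hℓ : ∀ i, 0 < L i / m i := fun i => div_pos (hL i) (by exact_mod_cast hm i)
  have split : ∀ g : (Fin n → ℝ) → ℝ, Continuous g →
      ∫ x in Set.Icc 0 L, g x = ∑ J, ∫ x in cell L m J, g x := by
    intro g hg
    rw [← setIntegral_congr_set (pi_Ioc_ae n L), ← iUnion_cell L hL m hm]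
    refine integral_iUnion_fintype (cell_measurable L m) (cell_disjoint L hL m hm) fun J => ?_
    have hsub : cell L m J ⊆ Set.Icc 0 L := by
      intro x hx
      have : x ∈ ⋃ J, cell L m J := Set.mem_iUnion.2 ⟨J, hx⟩
      rw [iUnion_cell L hL m hm] at this
      exact ⟨fun i => (this i (Set.mem_univ i)).1.le, fun i => (this i (Set.mem_univ i)).2⟩
    exact (hg.integrableOn_Icc).mono_set hsub
  have hDc : ∀ i, Continuous fun x => fderiv ℝ f x (Pi.single i 1) := fun i =>
    (hf.continuous_fderiv (by norm_num)).clm_apply continuous_const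
  rw [split (fun x => f x ^ 2) (hf.continuous.pow 2)]
  have : ∀ i, ∫ x in Set.Icc 0 L, (fderiv ℝ f x (Pi.single i 1)) ^ 2
    = ∑ J, ∫ x in cell L m J, (fderiv ℝ f x (Pi.single i 1)) ^ 2 := fun i => split _ ((hDc i).pow 2)
  simp_rw [this]
  rw [Finset.sum_comm, Finset.mul_sum]
  refine Finset.sum_le_sum fun J _ => ?_
  refine cell_poincare _ _ (fun i => ?_) (fun i => ?_) hf (h0 J)
  · have := hℓ i
    nlinarith
  · have := hs i
    linarith

end OUB


namespace OUB

/-- frequency -/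
noncomputable def kap (L : ℝ) (j : ℕ) : ℝ := Real.pi * j / L

/-- cosine overlap -/
noncomputable def cosI (L : ℝ) (a b : ℕ) : ℝ :=
  ∫ x in Set.Icc 0 L, Real.cos (kap L a * x) * Real.cos (kap L b * x)

lemma sin_end {L : ℝ} (hL : 0 < L) (j : ℕ) : Real.sin (kap L j * L) = 0 := by
  have : kap L j * L = j * Real.pi := by unfold kap; field_simp
  rw [this, Real.sin_nat_mul_pi]

lemma sinI {L : ℝ} (hL : 0 < L) (a b : ℕ) :
    ∫ x in Set.Icc 0 L, (-kap L a * Real.sin (kap L a * x)) * (-kap L b * Real.sin (kap L b * x))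
      = kap L b ^ 2 * cosI L a b := by
  have h : ∫ x in (0 : ℝ)..L, ((-kap L a * Real.sin (kap L a * x)) * (-kap L b * Real.sin (kap L b * x))
      - kap L b ^ 2 * (Real.cos (kap L a * x) * Real.cos (kap L b * x))) = 0 := by
    rw [intervalIntegral.integral_eq_sub_of_hasDerivAt
      (f := fun x => Real.cos (kap L a * x) * (-kap L b * Real.sin (kap L b * x)))]
    · simp [sin_end hL]
    · intro x _
      have h1 : HasDerivAt (fun x => Real.cos (kap L a * x)) (-Real.sin (kap L a * x) * (kap L a * 1)) x :=
        ((hasDerivAt_id x).const_mul _).cos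
      have h2 : HasDerivAt (fun x => Real.sin (kap L b * x)) (Real.cos (kap L b * x) * (kap L b * 1)) x :=
        ((hasDerivAt_id x).const_mul _).sin
      exact (h1.mul (h2.const_mul (-kap L b))).congr_deriv (by ring)
    · exact Continuous.intervalIntegrable (by fun_prop) _ _
  rw [intervalIntegral.integral_sub (Continuous.intervalIntegrable (by fun_prop) _ _)
    (Continuous.intervalIntegrable (by fun_prop) _ _), intervalIntegral.integral_const_mul] at h
  rw [cosI, integral_Icc_eq_integral_Ioc, integral_Icc_eq_integral_Ioc,
    ← intervalIntegral.integral_of_le hL.le, ← intervalIntegral.integral_of_le hL.le]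
  linarith

lemma cosI_comm (L : ℝ) (a b : ℕ) : cosI L a b = cosI L b a := by
  simp only [cosI, mul_comm]

lemma kap_nonneg {L : ℝ} (hL : 0 < L) (a : ℕ) : 0 ≤ kap L a := by
  unfold kap; have := Real.pi_pos; positivity

lemma cosI_ne {L : ℝ} (hL : 0 < L) {a b : ℕ} (hab : a ≠ b) : cosI L a b = 0 := by
  have h1 := sinI hL a b
  have h2 := sinI hL b a
  rw [cosI_comm L b a] at h2
  have h3 : kap L b ^ 2 * cosI L a b = kap L a ^ 2 * cosI L a b := by
    rw [← h1, ← h2]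
    congr 1
    funext x
    ring
  by_contra hne
  have h4 := mul_right_cancel₀ hne h3
  rw [sq_eq_sq₀ (kap_nonneg hL b) (kap_nonneg hL a)] at h4
  unfold kap at h4
  have := Real.pi_pos
  field_simp at h4
  exact hab (by exact_mod_cast h4.symm)

lemma cosI_pos {L : ℝ} (hL : 0 < L) (a : ℕ) : 0 < cosI L a a := by
  rw [cosI, integral_Icc_eq_integral_Ioc, ← intervalIntegral.integral_of_le hL.le]
  refine intervalIntegral.integral_pos hL (by fun_prop) (fun x _ => mul_self_nonneg _)
    ⟨0, ⟨le_rfl, hL.le⟩, by simp⟩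

/-- product of cosines -/
noncomputable def Phi {n : ℕ} (L : Fin n → ℝ) (J : Fin n → ℕ) (x : Fin n → ℝ) : ℝ :=
  ∏ i, Real.cos (kap (L i) (J i) * x i)

lemma Phi_contDiff {n : ℕ} (L : Fin n → ℝ) (J : Fin n → ℕ) {r : WithTop ℕ∞} : ContDiff ℝ r (Phi L J) := by
  unfold Phi
  refine contDiff_prod fun i _ => ?_
  exact Real.contDiff_cos.comp (contDiff_const.mul (contDiff_apply ℝ ℝ i))

lemma Phi_fderiv {n : ℕ} (L : Fin n → ℝ) (J : Fin n → ℕ) (x : Fin n → ℝ) (i : Fin n) :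
    fderiv ℝ (Phi L J) x (Pi.single i 1) =
      ∏ j, (if j = i then -kap (L j) (J j) * Real.sin (kap (L j) (J j) * x j)
        else Real.cos (kap (L j) (J j) * x j)) := by
  have h1 := hasDerivAt_update_comp (Phi_contDiff L J) x i (x i)
  rw [Function.update_eq_self] at h1
  rw [← Finset.mul_prod_erase _ _ (Finset.mem_univ i), if_pos rfl]
  have e : ∏ j ∈ Finset.univ.erase i, (if j = i then -kap (L j) (J j) * Real.sin (kap (L j) (J j) * x j)
        else Real.cos (kap (L j) (J j) * x j)) = ∏ j ∈ Finset.univ.erase i, Real.cos (kap (L j) (J j) * x j) :=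
    Finset.prod_congr rfl fun j hj => if_neg (Finset.ne_of_mem_erase hj)
  rw [e]
  refine h1.unique ?_
  have e2 : (fun t => Phi L J (Function.update x i t)) = fun t => Real.cos (kap (L i) (J i) * t) *
      ∏ j ∈ Finset.univ.erase i, Real.cos (kap (L j) (J j) * x j) := by
    funext t
    rw [Phi, ← Finset.mul_prod_erase _ _ (Finset.mem_univ i), Function.update_self]
    congr 1
    exact Finset.prod_congr rfl fun j hj => by rw [Function.update_of_ne (Finset.ne_of_mem_erase hj)]
  rw [e2]
  have h2 : HasDerivAt (fun t => Real.cos (kap (L i) (J i) * t))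
    (-Real.sin (kap (L i) (J i) * x i) * (kap (L i) (J i) * 1)) (x i) :=
        ((hasDerivAt_id (x i)).const_mul _).cos
  exact (h2.mul_const _).congr_deriv (by ring)

lemma integral_box_prod {n : ℕ} (L : Fin n → ℝ) (h : Fin n → ℝ → ℝ) :
    ∫ x in Set.Icc 0 L, ∏ i, h i (x i) = ∏ i, ∫ t in Set.Icc 0 (L i), h i t := by
  have : (volume : Measure (Fin n → ℝ)).restrict (Set.Icc 0 L)
      = Measure.pi fun i => volume.restrict (Set.Icc 0 (L i)) := by
    rw [← Set.pi_univ_Icc, volume_pi, Measure.restrict_pi_pi]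
    rfl
  rw [this, integral_fintype_prod_eq_prod (fun i t => h i t)]

/-- norm weight -/
noncomputable def wt {n : ℕ} (L : Fin n → ℝ) (J : Fin n → ℕ) : ℝ := ∏ i, cosI (L i) (J i) (J i)

lemma wt_pos {n : ℕ} (L : Fin n → ℝ) (hL : ∀ i, 0 < L i) (J : Fin n → ℕ) : 0 < wt L J :=
  Finset.prod_pos fun i _ => cosI_pos (hL i) _

lemma prod_cosI {n : ℕ} (L : Fin n → ℝ) (hL : ∀ i, 0 < L i) (J K : Fin n → ℕ) :
    ∏ i, cosI (L i) (J i) (K i) = if J = K then wt L J else 0 := by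
  split_ifs with h
  · subst h; rfl
  · obtain ⟨i, hi⟩ := Function.ne_iff.1 h
    exact Finset.prod_eq_zero (Finset.mem_univ i) (cosI_ne (hL i) hi)

lemma Phi_orth {n : ℕ} (L : Fin n → ℝ) (hL : ∀ i, 0 < L i) (J K : Fin n → ℕ) :
    ∫ x in Set.Icc 0 L, Phi L J x * Phi L K x = if J = K then wt L J else 0 := by
  rw [← prod_cosI L hL]
  unfold Phi cosI
  rw [← integral_box_prod L (fun i t => Real.cos (kap (L i) (J i) * t) * Real.cos (kap (L i) (K i) * t))]
  simp_rw [Finset.prod_mul_distrib]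

lemma dPhi_orth {n : ℕ} (L : Fin n → ℝ) (hL : ∀ i, 0 < L i) (J K : Fin n → ℕ) (i : Fin n) :
    ∫ x in Set.Icc 0 L, fderiv ℝ (Phi L J) x (Pi.single i 1) * fderiv ℝ (Phi L K) x (Pi.single i 1)
      = if J = K then kap (L i) (J i) ^ 2 * wt L J else 0 := by
  have e : (if J = K then kap (L i) (J i) ^ 2 * wt L J else 0)
      = kap (L i) (K i) ^ 2 * ∏ i, cosI (L i) (J i) (K i) := by
    rw [prod_cosI L hL]
    split_ifs with h
    · rw [h]
    · simp
  rw [e]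
  simp_rw [Phi_fderiv, ← Finset.prod_mul_distrib]
  rw [integral_box_prod L (fun j t => (if j = i then -kap (L j) (J j) * Real.sin (kap (L j) (J j) * t)
        else Real.cos (kap (L j) (J j) * t)) * (if j = i then -kap (L j) (K j) * Real.sin (kap (L j) (K j) * t)
        else Real.cos (kap (L j) (K j) * t)))]
  rw [← Finset.mul_prod_erase _ _ (Finset.mem_univ i), ← Finset.mul_prod_erase _ _ (Finset.mem_univ i),
    ← mul_assoc]
  congr 1
  · simp only [if_true]
    exact sinI (hL i) _ _
  · refine Finset.prod_congr rfl fun j hj => ?_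
    simp only [if_neg (Finset.ne_of_mem_erase hj)]
    rfl

lemma quad_sum {n k : ℕ} (L : Fin n → ℝ) (g : Fin k → (Fin n → ℝ) → ℝ) (hg : ∀ a, Continuous (g a))
    (w : Fin k → ℝ) (ho : ∀ a b, ∫ x in Set.Icc 0 L, g a x * g b x = if a = b then w a else 0)
    (c : Fin k → ℝ) :
    ∫ x in Set.Icc 0 L, (∑ a, c a * g a x) ^ 2 = ∑ a, c a ^ 2 * w a := by
  have e : ∀ x, (∑ a, c a * g a x) ^ 2 = ∑ a, ∑ b, (c a * c b) * (g a x * g b x) := by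
    intro x
    rw [sq, Finset.sum_mul_sum]
    refine Finset.sum_congr rfl fun a _ => Finset.sum_congr rfl fun b _ => by ring
  simp_rw [e]
  have hi : ∀ a b, Integrable (fun x => (c a * c b) * (g a x * g b x)) (volume.restrict (Set.Icc 0 L)) :=
    fun a b => (continuous_const.mul ((hg a).mul (hg b))).integrableOn_Icc
  rw [integral_finsetSum _ fun a _ => integrable_finsetSum _ fun b _ => hi a b]
  refine Finset.sum_congr rfl fun a _ => ?_
  rw [integral_finsetSum _ fun b _ => hi a b]
  simp_rw [integral_const_mul, ho]
  simp [sq]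

/-- main facts about combinations of cosine products -/
lemma cos_comb {n k : ℕ} (L : Fin n → ℝ) (hL : ∀ i, 0 < L i) (J : Fin k → Fin n → ℕ)
    (hJ : Function.Injective J) (c : Fin k → ℝ) :
    ∫ x in Set.Icc 0 L, (∑ a, c a * Phi L (J a) x) ^ 2 = ∑ a, c a ^ 2 * wt L (J a) := by
  refine quad_sum L (fun a => Phi L (J a)) (fun a => (Phi_contDiff (r := 0) L (J a)).continuous) _ (fun a b => ?_) c
  rw [Phi_orth L hL]
  simp [hJ.eq_iff]

lemma dcos_comb {n k : ℕ} (L : Fin n → ℝ) (hL : ∀ i, 0 < L i) (J : Fin k → Fin n → ℕ)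
    (hJ : Function.Injective J) (c : Fin k → ℝ) (i : Fin n) :
    ∫ x in Set.Icc 0 L, (fderiv ℝ (fun x => ∑ a, c a * Phi L (J a) x) x (Pi.single i 1)) ^ 2
      = ∑ a, c a ^ 2 * (kap (L i) (J a i) ^ 2 * wt L (J a)) := by
  have e : ∀ x, fderiv ℝ (fun x => ∑ a, c a * Phi L (J a) x) x (Pi.single i 1)
      = ∑ a, c a * fderiv ℝ (Phi L (J a)) x (Pi.single i 1) := by
    intro x
    have hd : ∀ a, HasFDerivAt (Phi L (J a)) (fderiv ℝ (Phi L (J a)) x) x := fun a =>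
      ((Phi_contDiff (r := 1) L (J a)).differentiable (by norm_num) x).hasFDerivAt
    have := HasFDerivAt.fun_sum (u := Finset.univ) fun a _ => (hd a).const_mul (c a)
    rw [this.fderiv]
    simp
  simp_rw [e]
  refine quad_sum L (fun a x => fderiv ℝ (Phi L (J a)) x (Pi.single i 1)) (fun a => ?_) _ (fun a b => ?_) c
  · exact ((Phi_contDiff (r := 1) L (J a)).continuous_fderiv (by norm_num)).clm_apply continuous_const
  rw [dPhi_orth L hL]
  simp [hJ.eq_iff]

end OUB

namespace OUB

/-- Coordinates identifying an orthotope with a standard box. -/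
structure Chart (n : ℕ) (Ω : Set (EuclideanSpace ℝ (Fin n))) where
  L : Fin n → ℝ
  hL : ∀ i, 0 < L i
  Ψ : (Fin n → ℝ) ≃ₜ EuclideanSpace ℝ (Fin n)
  smooth : ∀ r : WithTop ℕ∞, ContDiff ℝ r Ψ
  smooth_symm : ∀ r : WithTop ℕ∞, ContDiff ℝ r Ψ.symm
  mp : MeasurePreserving Ψ
  img : Ω = Ψ '' Set.Icc 0 L
  grad : ∀ f : EuclideanSpace ℝ (Fin n) → ℝ, Differentiable ℝ f → ∀ y,
    ‖fderiv ℝ f (Ψ y)‖ ^ 2 = ∑ i, (fderiv ℝ (fun y => f (Ψ y)) y (Pi.single i 1)) ^ 2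

lemma dual_norm_sq {n : ℕ} (b : OrthonormalBasis (Fin n) ℝ (EuclideanSpace ℝ (Fin n)))
    (φ : EuclideanSpace ℝ (Fin n) →L[ℝ] ℝ) : ‖φ‖ ^ 2 = ∑ i, (φ (b i)) ^ 2 := by
  obtain ⟨v, rfl⟩ := (InnerProductSpace.toDual ℝ (EuclideanSpace ℝ (Fin n))).surjective φ
  rw [LinearIsometryEquiv.norm_map, ← b.sum_sq_inner_left]
  simp

lemma exists_chart {n : ℕ} {Ω : Set (EuclideanSpace ℝ (Fin n))} (h : IsOrthotope n Ω) :
    Nonempty (Chart n Ω) := by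
  obtain ⟨T, a, ha, rfl⟩ := h
  set A := T.toRealLinearIsometryEquiv with hA
  have hT : ∀ x, T x = A x + T 0 := fun x => by
    rw [hA, IsometryEquiv.toRealLinearIsometryEquiv_apply]; simp
  have hTs : ∀ x, T.symm x = A.symm (x - T 0) := fun x => by
    rw [T.symm_apply_eq, hT]; simp
  let E := (EuclideanSpace.equiv (Fin n) ℝ)
  let Ψ : (Fin n → ℝ) ≃ₜ EuclideanSpace ℝ (Fin n) :=
    ((Homeomorph.subRight a).trans E.symm.toHomeomorph).trans T.toHomeomorph
  have hΨ : ∀ y, Ψ y = A (E.symm (y - a)) + T 0 := fun y => hT _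
  have hΨs : ∀ x, Ψ.symm x = E (A.symm (x - T 0)) + a := fun x => by
    show E (T.symm x) + a = _
    rw [hTs]
  have hd : ∀ y, HasFDerivAt Ψ
      ((A.toContinuousLinearEquiv : EuclideanSpace ℝ (Fin n) →L[ℝ] EuclideanSpace ℝ (Fin n)).comp
        (E.symm : (Fin n → ℝ) →L[ℝ] EuclideanSpace ℝ (Fin n))) y := by
    intro y
    have h1 : HasFDerivAt (fun y => y - a) (ContinuousLinearMap.id ℝ (Fin n → ℝ)) y :=
      (hasFDerivAt_id y).sub_const a
    have h2 := (((A.toContinuousLinearEquiv : EuclideanSpace ℝ (Fin n) →L[ℝ] EuclideanSpace ℝ (Fin n)).comp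
        (E.symm : (Fin n → ℝ) →L[ℝ] EuclideanSpace ℝ (Fin n))).hasFDerivAt.comp y h1).add_const (T 0)
    have e : (Ψ : (Fin n → ℝ) → EuclideanSpace ℝ (Fin n)) = fun y => A (E.symm (y - a)) + T 0 := funext hΨ
    rw [e]
    exact h2
  refine ⟨⟨fun i => 2 * a i, fun i => by have := ha i; positivity, Ψ, ?_, ?_, ?_, ?_, ?_⟩⟩
  · intro r
    have e : (Ψ : (Fin n → ℝ) → EuclideanSpace ℝ (Fin n)) = fun y => A (E.symm (y - a)) + T 0 := funext hΨ
    rw [e]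
    exact (A.contDiff.comp (E.symm.contDiff.comp (contDiff_id.sub contDiff_const))).add contDiff_const
  · intro r
    have e : (Ψ.symm : EuclideanSpace ℝ (Fin n) → (Fin n → ℝ)) = fun x => E (A.symm (x - T 0)) + a := funext hΨs
    rw [e]
    exact (E.contDiff.comp (A.symm.contDiff.comp (contDiff_id.sub contDiff_const))).add contDiff_const
  · have e : (Ψ : (Fin n → ℝ) → EuclideanSpace ℝ (Fin n)) =
      (fun x => x + T 0) ∘ A ∘ (WithLp.toLp 2) ∘ fun y => y - a := funext hΨ
    rw [e]
    exact (measurePreserving_add_right volume (T 0)).comp (A.measurePreserving.comp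
      ((PiLp.volume_preserving_toLp (Fin n)).comp (measurePreserving_sub_right volume a)))
  · have e : {x : EuclideanSpace ℝ (Fin n) | ∀ i, |x i| ≤ a i}
        = (fun y => E.symm (y - a)) '' Set.Icc 0 (fun i => 2 * a i) := by
      ext x
      constructor
      · intro hx
        refine ⟨E x + a, ⟨fun i => ?_, fun i => ?_⟩, by simp⟩
        · have := abs_le.1 (hx i)
          show (0 : ℝ) ≤ x i + a i
          linarith
        · have := abs_le.1 (hx i)
          show x i + a i ≤ 2 * a i
          linarith
      · rintro ⟨y, hy, rfl⟩ i
        show |y i - a i| ≤ a i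
        have h1 := hy.1 i
        have h2 := hy.2 i
        simp only [Pi.zero_apply] at h1
        rw [abs_le]
        constructor <;> linarith
    rw [e, Set.image_image]
    rfl
  · intro f hf y
    rw [dual_norm_sq ((EuclideanSpace.basisFun (Fin n) ℝ).map A)]
    refine Finset.sum_congr rfl fun i _ => ?_
    have := ((hf (Ψ y)).hasFDerivAt.comp y (hd y)).fderiv
    have e : fderiv ℝ (fun y => f (Ψ y)) y = _ := this
    rw [e]
    simp
    rfl

end OUB


namespace OUB

variable {n : ℕ} {Ω : Set (EuclideanSpace ℝ (Fin n))}

lemma Chart.int_comp (C : Chart n Ω) (g : EuclideanSpace ℝ (Fin n) → ℝ) :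
    ∫ x in Ω, g x = ∫ y in Set.Icc 0 C.L, g (C.Ψ y) := by
  have := C.mp.setIntegral_image_emb C.Ψ.measurableEmbedding g (Set.Icc 0 C.L)
  rwa [← C.img] at this

lemma Chart.comp_smooth (C : Chart n Ω) {f : EuclideanSpace ℝ (Fin n) → ℝ}
    (hf : ContDiff ℝ (⊤ : ℕ∞) f) : ContDiff ℝ 1 (fun y => f (C.Ψ y)) :=
  (hf.of_le (by exact_mod_cast le_top)).comp (C.smooth 1)

lemma Chart.d_cont (C : Chart n Ω) {f : EuclideanSpace ℝ (Fin n) → ℝ}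
    (hf : ContDiff ℝ (⊤ : ℕ∞) f) (i : Fin n) :
    Continuous (fun y => fderiv ℝ (fun y => f (C.Ψ y)) y (Pi.single i 1)) :=
  ((C.comp_smooth hf).continuous_fderiv (by norm_num)).clm_apply continuous_const

lemma Chart.int_grad (C : Chart n Ω) {f : EuclideanSpace ℝ (Fin n) → ℝ}
    (hf : ContDiff ℝ (⊤ : ℕ∞) f) :
    ∫ x in Ω, ‖fderiv ℝ f x‖ ^ 2
      = ∑ i, ∫ y in Set.Icc 0 C.L, (fderiv ℝ (fun y => f (C.Ψ y)) y (Pi.single i 1)) ^ 2 := by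
  rw [C.int_comp (fun x => ‖fderiv ℝ f x‖ ^ 2)]
  simp_rw [C.grad f (hf.differentiable (by simp))]
  exact integral_finsetSum _ fun i _ => ((C.d_cont hf i).pow 2).integrableOn_Icc

lemma box_sq_zero (L : Fin n → ℝ) (hL : ∀ i, 0 < L i) {f : (Fin n → ℝ) → ℝ} (hf : Continuous f)
    (h : ∫ x in Set.Icc 0 L, f x ^ 2 = 0) : ∀ x ∈ Set.Icc 0 L, f x = 0 := by
  have hi : IntegrableOn (fun x => f x ^ 2) (Set.Icc 0 L) := (hf.pow 2).integrableOn_Icc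
  have h1 := (setIntegral_eq_zero_iff_of_nonneg_ae (Filter.Eventually.of_forall fun x => sq_nonneg (f x)) hi).1 h
  have h2 : f =ᵐ[volume.restrict (Set.Icc 0 L)] fun _ => 0 := by
    filter_upwards [h1] with x hx
    simpa using hx
  refine Measure.eqOn_of_ae_eq h2 hf.continuousOn continuousOn_const ?_
  rw [← Set.pi_univ_Icc, interior_pi_set Set.finite_univ, closure_pi_set]
  refine Set.pi_mono fun i _ => ?_
  simp only [interior_Icc]
  rw [closure_Ioo]
  exact (hL i).ne

lemma Chart.pos (C : Chart n Ω) {f : EuclideanSpace ℝ (Fin n) → ℝ}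
    (hf : ContDiff ℝ (⊤ : ℕ∞) f) (h : ∫ y in Set.Icc 0 C.L, f (C.Ψ y) ^ 2 = 0) : ∀ x ∈ Ω, f x = 0 := by
  have := box_sq_zero C.L C.hL (C.comp_smooth hf).continuous h
  intro x hx
  rw [C.img] at hx
  obtain ⟨y, hy, rfl⟩ := hx
  exact this y hy

lemma norm_toLp_sq {X : Type*} [MeasurableSpace X] (μ : Measure X) {f : X → ℝ} (hf : MemLp f 2 μ) :
    ‖hf.toLp f‖ ^ 2 = ∫ x, f x ^ 2 ∂μ := by
  rw [← real_inner_self_eq_norm_sq, L2.inner_def]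
  refine integral_congr_ae ?_
  filter_upwards [hf.coeFn_toLp] with x hx
  rw [hx]
  simp [sq]

lemma fin_dim_bound {X W : Type*} [MeasurableSpace X] (μ : Measure X) [AddCommGroup W] [Module ℝ W]
    [FiniteDimensional ℝ W] (S T : W →ₗ[ℝ] (X → ℝ)) (hS : ∀ w, MemLp (S w) 2 μ)
    (hT : ∀ w, MemLp (T w) 2 μ) (h0 : ∀ w, ∫ x, S w x ^ 2 ∂μ = 0 → w = 0) :
    ∃ C : ℝ, 0 ≤ C ∧ ∀ w, ∫ x, T w x ^ 2 ∂μ ≤ C * ∫ x, S w x ^ 2 ∂μ := by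
  let S' : W →ₗ[ℝ] Lp ℝ 2 μ :=
    { toFun := fun w => (hS w).toLp (S w)
      map_add' := fun v w => by
        rw [← MemLp.toLp_add]; congr 1; exact map_add _ _ _
      map_smul' := fun c w => by
        rw [RingHom.id_apply, ← MemLp.toLp_const_smul]; congr 1; exact map_smul _ _ _ }
  let T' : W →ₗ[ℝ] Lp ℝ 2 μ :=
    { toFun := fun w => (hT w).toLp (T w)
      map_add' := fun v w => by
        rw [← MemLp.toLp_add]; congr 1; exact map_add _ _ _
      map_smul' := fun c w => by
        rw [RingHom.id_apply, ← MemLp.toLp_const_smul]; congr 1; exact map_smul _ _ _ }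
  have hinj : Function.Injective S' := by
    rw [← LinearMap.ker_eq_bot, LinearMap.ker_eq_bot']
    intro w hw
    apply h0
    rw [← norm_toLp_sq μ (hS w)]
    have : (hS w).toLp (S w) = 0 := hw
    rw [this]; simp
  let e := LinearEquiv.ofInjective S' hinj
  let G : LinearMap.range S' →L[ℝ] Lp ℝ 2 μ := LinearMap.toContinuousLinearMap (T'.comp e.symm.toLinearMap)
  refine ⟨‖G‖ ^ 2, by positivity, fun w => ?_⟩
  have h1 := G.le_opNorm (e w)
  have h2 : G (e w) = (hT w).toLp (T w) := by
    show T' (e.symm (e w)) = _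
    rw [e.symm_apply_apply]; rfl
  have h3 : ‖e w‖ = ‖(hS w).toLp (S w)‖ := rfl
  rw [h2, h3] at h1
  rw [← norm_toLp_sq μ (hS w), ← norm_toLp_sq μ (hT w), ← mul_pow]
  exact pow_le_pow_left₀ (norm_nonneg _) h1 2

lemma memLp_box (L : Fin n → ℝ) {f : (Fin n → ℝ) → ℝ} (hf : Continuous f) :
    MemLp f 2 (volume.restrict (Set.Icc 0 L)) := by
  obtain ⟨C, hC⟩ := (isCompact_Icc (a := (0 : Fin n → ℝ)) (b := L)).exists_bound_of_continuousOn hf.continuousOn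
  have : IsFiniteMeasure (volume.restrict (Set.Icc 0 L)) :=
    ⟨by rw [Measure.restrict_apply_univ]; exact isCompact_Icc.measure_lt_top⟩
  exact MemLp.of_bound hf.aestronglyMeasurable C
    ((ae_restrict_mem measurableSet_Icc).mono fun x hx => hC x hx)

lemma Chart.bdd (C : Chart n Ω) (V : Submodule ℝ (EuclideanSpace ℝ (Fin n) → ℝ))
    [FiniteDimensional ℝ V] (hV : ∀ f ∈ V, ContDiff ℝ (⊤ : ℕ∞) f)
    (hV0 : ∀ f ∈ V, (∀ x ∈ Ω, f x = 0) → f = 0) :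
    BddAbove (Set.range fun f : {f : EuclideanSpace ℝ (Fin n) → ℝ // f ∈ V ∧ f ≠ 0} =>
      (∫ x in Ω, ‖fderiv ℝ f.1 x‖ ^ 2) / ∫ x in Ω, (f.1 x) ^ 2) := by
  let S : V →ₗ[ℝ] ((Fin n → ℝ) → ℝ) :=
    { toFun := fun f y => f.1 (C.Ψ y)
      map_add' := fun f g => rfl
      map_smul' := fun c f => rfl }
  have hdiff : ∀ (f : V) y, DifferentiableAt ℝ (fun y => f.1 (C.Ψ y)) y := fun f y =>
    (C.comp_smooth (hV f.1 f.2)).differentiable (by norm_num) y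
  let T : Fin n → V →ₗ[ℝ] ((Fin n → ℝ) → ℝ) := fun i =>
    { toFun := fun f y => fderiv ℝ (fun y => f.1 (C.Ψ y)) y (Pi.single i 1)
      map_add' := fun f g => by
        funext y
        have := fderiv_fun_add (hdiff f y) (hdiff g y)
        show fderiv ℝ (fun y => f.1 (C.Ψ y) + g.1 (C.Ψ y)) y (Pi.single i 1) = _
        rw [this]; rfl
      map_smul' := fun c f => by
        funext y
        have := fderiv_fun_const_smul (hdiff f y) c
        show fderiv ℝ (fun y => c • f.1 (C.Ψ y)) y (Pi.single i 1) = _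
        rw [this]; rfl }
  have key := fun i => fin_dim_bound (volume.restrict (Set.Icc 0 C.L)) S (T i)
    (fun f => memLp_box _ (C.comp_smooth (hV f.1 f.2)).continuous)
    (fun f => memLp_box _ (C.d_cont (hV f.1 f.2) i))
    (fun f h => Subtype.ext (hV0 f.1 f.2 (C.pos (hV f.1 f.2) h)))
  choose K hK0 hK using key
  refine ⟨∑ i, K i, ?_⟩
  rintro _ ⟨⟨f, hf, hf0⟩, rfl⟩
  simp only
  refine div_le_of_le_mul₀ (integral_nonneg fun x => sq_nonneg _) (Finset.sum_nonneg fun i _ => hK0 i) ?_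
  rw [C.int_grad (hV f hf), C.int_comp (fun x => f x ^ 2), Finset.sum_mul]
  exact Finset.sum_le_sum fun i _ => hK i ⟨f, hf⟩

lemma Chart.lower (C : Chart n Ω) (l : ℕ) (m : Fin n → ℕ) (hm : ∀ i, 0 < m i) {s : ℝ} (hs0 : 0 < s)
    (hs : ∀ i, C.L i / m i ≤ s) (hml : ∏ i, m i ≤ l)
    (hne : Nonempty {V : Submodule ℝ (EuclideanSpace ℝ (Fin n) → ℝ) //
      Module.finrank ℝ V = l + 1 ∧ (∀ f ∈ V, ContDiff ℝ (⊤ : ℕ∞) f) ∧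
      ∀ f ∈ V, (∀ x ∈ Ω, f x = 0) → f = 0}) :
    2 / s ^ 2 ≤ neumannEigenvalue n l Ω := by
  unfold neumannEigenvalue
  refine le_ciInf fun V => ?_
  obtain ⟨V, hdim, hV, hV0⟩ := V
  have : FiniteDimensional ℝ V := FiniteDimensional.of_finrank_pos (by omega)
  have hsub : ∀ J, cell C.L m J ⊆ Set.Icc 0 C.L := by
    intro J x hx
    have : x ∈ ⋃ J, cell C.L m J := Set.mem_iUnion.2 ⟨J, hx⟩
    rw [iUnion_cell C.L C.hL m hm] at this
    exact ⟨fun i => (this i (Set.mem_univ i)).1.le, fun i => (this i (Set.mem_univ i)).2⟩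
  have hInt : ∀ (f : V) J, IntegrableOn (fun y => f.1 (C.Ψ y)) (cell C.L m J) := fun f J =>
    ((C.comp_smooth (hV f.1 f.2)).continuous.integrableOn_Icc).mono_set (hsub J)
  let M : V →ₗ[ℝ] (((i : Fin n) → Fin (m i)) → ℝ) :=
    { toFun := fun f J => ∫ y in cell C.L m J, f.1 (C.Ψ y)
      map_add' := fun f g => by
        funext J
        exact integral_add (hInt f J) (hInt g J)
      map_smul' := fun c f => by
        funext J
        exact integral_const_mul c _ }
  have hker : LinearMap.ker M ≠ ⊥ := by
    apply LinearMap.ker_ne_bot_of_finrank_lt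
    rw [hdim, Module.finrank_fintype_fun_eq_card, Fintype.card_pi]
    simp only [Fintype.card_fin]
    omega
  obtain ⟨⟨f, hf⟩, hfk, hf0⟩ := (Submodule.ne_bot_iff _).1 hker
  have hf0' : f ≠ 0 := fun h => hf0 (Subtype.ext h)
  have hcell : ∀ J, ∫ y in cell C.L m J, f (C.Ψ y) = 0 := fun J => congrFun (LinearMap.mem_ker.1 hfk) J
  have hP := box_poincare C.L C.hL m hm hs (C.comp_smooth (hV f hf)) hcell
  refine le_trans ?_ (le_ciSup (C.bdd V hV hV0) ⟨f, hf, hf0'⟩)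
  simp only
  rw [C.int_grad (hV f hf), C.int_comp (fun x => f x ^ 2)]
  have hN : 0 < ∫ y in Set.Icc 0 C.L, f (C.Ψ y) ^ 2 := by
    refine lt_of_le_of_ne (integral_nonneg fun x => sq_nonneg _) fun h => ?_
    exact hf0' (hV0 f hf (C.pos (hV f hf) h.symm))
  rw [le_div_iff₀ hN, div_mul_eq_mul_div, div_le_iff₀ (by positivity)]
  linarith

lemma Chart.upper (C : Chart n Ω) (k : ℕ) (J : Fin (k + 1) → Fin n → ℕ) (hJ : Function.Injective J)
    {K : ℝ} (hK : ∀ a i, kap (C.L i) (J a i) ^ 2 ≤ K) :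
    ∃ V : {V : Submodule ℝ (EuclideanSpace ℝ (Fin n) → ℝ) //
      Module.finrank ℝ V = k + 1 ∧ (∀ f ∈ V, ContDiff ℝ (⊤ : ℕ∞) f) ∧
      ∀ f ∈ V, (∀ x ∈ Ω, f x = 0) → f = 0},
      ∀ f ∈ V.1, ∫ x in Ω, ‖fderiv ℝ f x‖ ^ 2 ≤ n * K * ∫ x in Ω, (f x) ^ 2 := by
  let b : Fin (k + 1) → EuclideanSpace ℝ (Fin n) → ℝ := fun a x => Phi C.L (J a) (C.Ψ.symm x)
  have hcomb : ∀ c : Fin (k + 1) → ℝ, (fun y => (∑ a, c a • b a) (C.Ψ y))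
      = fun y => ∑ a, c a * Phi C.L (J a) y := by
    intro c
    funext y
    simp [b, Finset.sum_apply]
  have hb : ∀ a, ContDiff ℝ (⊤ : ℕ∞) (b a) := fun a => (Phi_contDiff C.L (J a)).comp (C.smooth_symm _)
  have hsm : ∀ c : Fin (k + 1) → ℝ, ContDiff ℝ (⊤ : ℕ∞) (∑ a, c a • b a) := by
    intro c
    have : (∑ a, c a • b a) = fun x => ∑ a, c a • b a x := by
      funext x; simp [Finset.sum_apply]
    rw [this]
    exact ContDiff.sum fun a _ => (hb a).const_smul (c a)
  have hN : ∀ c : Fin (k + 1) → ℝ, ∫ x in Ω, ((∑ a, c a • b a) x) ^ 2 = ∑ a, c a ^ 2 * wt C.L (J a) := by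
    intro c
    rw [C.int_comp (fun x => ((∑ a, c a • b a) x) ^ 2), ← cos_comb C.L C.hL J hJ c]
    have := hcomb c
    refine setIntegral_congr_fun measurableSet_Icc fun y _ => ?_
    simp only [congrFun this y]
  have hz : ∀ c : Fin (k + 1) → ℝ, (∀ x ∈ Ω, (∑ a, c a • b a) x = 0) → ∀ a, c a = 0 := by
    intro c h a
    have h1 : ∑ a, c a ^ 2 * wt C.L (J a) = 0 := by
      rw [← hN c]
      rw [C.int_comp (fun x => ((∑ a, c a • b a) x) ^ 2)]
      rw [setIntegral_congr_fun (g := fun _ => (0 : ℝ)) measurableSet_Icc]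
      · simp
      · intro y hy
        have := h (C.Ψ y) ((Set.ext_iff.1 C.img _).2 ⟨y, hy, rfl⟩)
        simp only [this]
        simp
    have h2 := (Finset.sum_eq_zero_iff_of_nonneg fun a _ =>
      mul_nonneg (sq_nonneg (c a)) (wt_pos C.L C.hL (J a)).le).1 h1 a (Finset.mem_univ a)
    have := (wt_pos C.L C.hL (J a)).ne'
    simpa [this] using h2
  have hli : LinearIndependent ℝ b := by
    rw [Fintype.linearIndependent_iff]
    intro c hc
    exact hz c fun x _ => by rw [hc]; rfl
  have hmem : ∀ f ∈ Submodule.span ℝ (Set.range b), ∃ c : Fin (k + 1) → ℝ, ∑ a, c a • b a = f :=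
    fun f hf => (Submodule.mem_span_range_iff_exists_fun ℝ).1 hf
  refine ⟨⟨Submodule.span ℝ (Set.range b), ?_, ?_, ?_⟩, ?_⟩
  · rw [finrank_span_eq_card hli]; simp
  · intro f hf
    obtain ⟨c, rfl⟩ := hmem f hf
    exact hsm c
  · intro f hf h
    obtain ⟨c, rfl⟩ := hmem f hf
    have := hz c h
    simp [this]
  · intro f hf
    obtain ⟨c, rfl⟩ := hmem f hf
    rw [hN, C.int_grad (hsm c), hcomb c]
    simp_rw [dcos_comb C.L C.hL J hJ c]
    calc _ ≤ ∑ i : Fin n, ∑ a, c a ^ 2 * (K * wt C.L (J a)) := by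
          refine Finset.sum_le_sum fun i _ => Finset.sum_le_sum fun a _ => ?_
          have := (wt_pos C.L C.hL (J a)).le
          have := hK a i
          gcongr
      _ = _ := by
          rw [Finset.sum_const, Finset.card_univ, Fintype.card_fin, nsmul_eq_mul, mul_assoc]
          congr 1
          rw [Finset.mul_sum]
          exact Finset.sum_congr rfl fun a _ => by ring

end OUB


namespace OUB

/-- box count -/
noncomputable def cnt {n : ℕ} (L : Fin n → ℝ) (s : ℝ) : ℕ := ∏ i, ⌈L i / s⌉₊

lemma exists_inj {n N : ℕ} (m : Fin n → ℕ) (h : N ≤ ∏ i, m i) :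
    ∃ J : Fin N → Fin n → ℕ, Function.Injective J ∧ ∀ a i, J a i < m i := by
  have hc : Fintype.card (Fin N) ≤ Fintype.card ((i : Fin n) → Fin (m i)) := by
    simpa [Fintype.card_pi] using h
  obtain ⟨e⟩ := Function.Embedding.nonempty_of_card_le hc
  refine ⟨fun a i => (e a i : ℕ), fun a b hab => e.injective (funext fun i => Fin.ext (congrFun hab i)),
    fun a i => (e a i).2⟩

lemma cnt_upper {n : ℕ} {Ω : Set (EuclideanSpace ℝ (Fin n))} (C : Chart n Ω) {s : ℝ} (hs : 0 < s)
    {k : ℕ} (hk : k + 1 ≤ cnt C.L s) :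
    ∃ V : {V : Submodule ℝ (EuclideanSpace ℝ (Fin n) → ℝ) //
      Module.finrank ℝ V = k + 1 ∧ (∀ f ∈ V, ContDiff ℝ (⊤ : ℕ∞) f) ∧
      ∀ f ∈ V, (∀ x ∈ Ω, f x = 0) → f = 0},
      ∀ f ∈ V.1, ∫ x in Ω, ‖fderiv ℝ f x‖ ^ 2 ≤ n * (Real.pi / s) ^ 2 * ∫ x in Ω, (f x) ^ 2 := by
  obtain ⟨J, hJ, hJm⟩ := exists_inj _ hk
  refine C.upper k J hJ fun a i => ?_
  refine pow_le_pow_left₀ (kap_nonneg (C.hL i) _) ?_ 2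
  have h1 : (J a i : ℝ) < C.L i / s := Nat.lt_ceil.1 (hJm a i)
  unfold kap
  rw [mul_div_assoc, div_eq_mul_one_div Real.pi s]
  refine mul_le_mul_of_nonneg_left ?_ Real.pi_pos.le
  rw [div_le_iff₀ (C.hL i)]
  refine h1.le.trans (le_of_eq ?_)
  ring

lemma neumann_le {n : ℕ} {Ω : Set (EuclideanSpace ℝ (Fin n))} (C : Chart n Ω) {s : ℝ} (hs : 0 < s)
    {k : ℕ} (hk : k + 1 ≤ cnt C.L s) : neumannEigenvalue n k Ω ≤ n * (Real.pi / s) ^ 2 := by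
  obtain ⟨V, hV⟩ := cnt_upper C hs hk
  unfold neumannEigenvalue
  refine (ciInf_le ⟨0, ?_⟩ V).trans ?_
  · rintro _ ⟨W, rfl⟩
    exact Real.iSup_nonneg fun f => div_nonneg (integral_nonneg fun x => sq_nonneg _)
      (integral_nonneg fun x => sq_nonneg _)
  · refine Real.iSup_le (fun f => ?_) (by positivity)
    exact div_le_of_le_mul₀ (integral_nonneg fun x => sq_nonneg _) (by positivity) (hV f.1 f.2.1)

lemma cnt_scale {n : ℕ} (L : Fin n → ℝ) (hL : ∀ i, 0 < L i) {s t : ℝ} (hs : 0 < s) (ht : 1 ≤ t)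
    (h2 : 2 ≤ cnt L s) : t / 2 * (cnt L s : ℝ) ≤ cnt L (s / t) := by
  have ht0 : 0 < t := by linarith
  obtain ⟨i, hi⟩ : ∃ i, 1 < L i / s := by
    by_contra! hcon
    have : cnt L s ≤ 1 := Finset.prod_le_one' fun i _ => by
      rw [Nat.ceil_le]; simpa using hcon i
    omega
  unfold cnt
  push_cast
  rw [← Finset.mul_prod_erase _ _ (Finset.mem_univ i), ← Finset.mul_prod_erase _ _ (Finset.mem_univ i),
    ← mul_assoc]
  refine mul_le_mul ?_ ?_ (Finset.prod_nonneg fun j _ => by positivity) (by positivity)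
  · have a := Nat.ceil_lt_add_one (zero_le_one.trans hi.le)
    have b := Nat.le_ceil (L i / (s / t))
    have e : L i / (s / t) = t * (L i / s) := by field_simp
    rw [e] at b
    rw [e]
    nlinarith
  · refine Finset.prod_le_prod (fun j _ => by positivity) fun j _ => ?_
    have : L j / s ≤ L j / (s / t) := by
      have e : L j / (s / t) = t * (L j / s) := by field_simp
      rw [e]
      have := div_pos (hL j) hs
      nlinarith
    exact_mod_cast Nat.ceil_mono this

lemma cnt_large {n : ℕ} (hn : 1 ≤ n) (L : Fin n → ℝ) (hL : ∀ i, 0 < L i) (l : ℕ) :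
    ∃ s, 0 < s ∧ cnt L s ≤ l + 1 ∧ l + 2 ≤ cnt L (s / 2) := by
  -- start from a large scale
  obtain ⟨s₀, hs₀, h₀⟩ : ∃ s₀ : ℝ, 0 < s₀ ∧ cnt L s₀ ≤ 1 := by
    refine ⟨∑ i, L i + 1, ?_, ?_⟩
    · have := Finset.sum_nonneg fun i (_ : i ∈ Finset.univ) => (hL i).le
      linarith
    · refine Finset.prod_le_one' fun i _ => ?_
      have h1 := Finset.single_le_sum (fun i (_ : i ∈ Finset.univ) => (hL i).le) (Finset.mem_univ i)
      have := hL i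
      rw [Nat.ceil_le, div_le_iff₀ (by linarith)]
      simp only [Nat.cast_one, one_mul]
      linarith
  have hex : ∃ j : ℕ, l + 2 ≤ cnt L (s₀ / 2 ^ j) := by
    let i₀ : Fin n := ⟨0, hn⟩
    obtain ⟨j, hj⟩ := pow_unbounded_of_one_lt ((l + 2 : ℝ) / (L i₀ / s₀)) one_lt_two
    refine ⟨j, ?_⟩
    have hp := div_pos (hL i₀) hs₀
    rw [div_lt_iff₀ hp] at hj
    have e : L i₀ / (s₀ / 2 ^ j) = 2 ^ j * (L i₀ / s₀) := by field_simp
    have h1 : l + 2 ≤ ⌈L i₀ / (s₀ / 2 ^ j)⌉₊ := by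
      rw [e]
      have := hj.le.trans (Nat.le_ceil _)
      exact_mod_cast this
    refine h1.trans ?_
    unfold cnt
    refine Finset.single_le_prod' (f := fun i => ⌈L i / (s₀ / 2 ^ j)⌉₊) (fun i _ => ?_) (Finset.mem_univ i₀)
    exact Nat.ceil_pos.2 (div_pos (hL i) (by positivity))
  classical
  have hspec := Nat.find_spec hex
  have hmin := fun j => Nat.find_min hex (m := j)
  obtain ⟨j, hj⟩ : ∃ j, Nat.find hex = j + 1 := by
    refine Nat.exists_eq_succ_of_ne_zero fun h => ?_
    rw [h] at hspec
    simp at hspec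
    omega
  refine ⟨s₀ / 2 ^ j, by positivity, ?_, ?_⟩
  · have := hmin j (by omega)
    omega
  · rw [hj] at hspec
    rwa [div_div, ← pow_succ]

end OUB

theorem orthotope_upper_bound :
    ∃ c : ℝ, 0 < c ∧ ∀ n : ℕ, 1 ≤ n →
      ∀ R : Set (EuclideanSpace ℝ (Fin n)), IsOrthotope n R →
        ∀ k l : ℕ, 1 ≤ l → l ≤ k →
          neumannEigenvalue n k R ≤
            c * (n : ℝ) ^ 3 * ((k : ℝ) / (l : ℝ)) ^ 2 * neumannEigenvalue n l R := by
  refine ⟨8 * Real.pi ^ 2, by have := Real.pi_pos; positivity, ?_⟩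
  intro n hn R hR k l hl hlk
  obtain ⟨C⟩ := OUB.exists_chart hR
  obtain ⟨l', rfl⟩ : ∃ l', l = l' + 1 := ⟨l - 1, by omega⟩
  obtain ⟨s, hs, h1, h2⟩ := OUB.cnt_large hn C.L C.hL l'
  set l := l' + 1 with hldef
  have hl0 : (0 : ℝ) < l := by exact_mod_cast hl
  have hkl : (l : ℝ) ≤ k := by exact_mod_cast hlk
  have hs2 : 0 < s / 2 := by positivity
  have hne := OUB.cnt_upper C hs2 (k := l) h2
  have hlow := C.lower l (fun i => ⌈C.L i / s⌉₊) (fun i => Nat.ceil_pos.2 (div_pos (C.hL i) hs)) hs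
    (fun i => by
      have hp : (0 : ℝ) < ⌈C.L i / s⌉₊ := by exact_mod_cast Nat.ceil_pos.2 (div_pos (C.hL i) hs)
      rw [div_le_iff₀ hp, mul_comm, ← div_le_iff₀ hs]
      exact Nat.le_ceil _) h1 ⟨hne.choose⟩
  set t : ℝ := 2 * ((k + 1) / (l + 1)) with htdef
  have ht1 : 1 ≤ t := by
    have : (1 : ℝ) ≤ (k + 1) / (l + 1) := by rw [le_div_iff₀ (by positivity)]; linarith
    linarith
  have ht2 : t ≤ 2 * (k / l) := by
    have : ((k : ℝ) + 1) / (l + 1) ≤ k / l := by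
      rw [div_le_div_iff₀ (by positivity) hl0]; nlinarith
    linarith
  have hk1 : k + 1 ≤ OUB.cnt C.L (s / 2 / t) := by
    have a := OUB.cnt_scale C.L C.hL hs2 ht1 (by omega)
    have b : ((l : ℝ) + 1) ≤ OUB.cnt C.L (s / 2) := by exact_mod_cast h2
    have c : (k : ℝ) + 1 ≤ t / 2 * OUB.cnt C.L (s / 2) := by
      calc (k : ℝ) + 1 = t / 2 * (l + 1) := by rw [htdef]; field_simp
        _ ≤ _ := by gcongr
    exact_mod_cast c.trans a
  have hup := OUB.neumann_le C (s := s / 2 / t) (by positivity) hk1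
  refine hup.trans ?_
  have hn1 : (1 : ℝ) ≤ n := by exact_mod_cast hn
  have hn3 : (n : ℝ) ≤ n ^ 3 := le_self_pow₀ hn1 (by norm_num)
  calc (n : ℝ) * (Real.pi / (s / 2 / t)) ^ 2 = 4 * Real.pi ^ 2 * n * t ^ 2 * (1 / s ^ 2) := by
        field_simp; ring
    _ ≤ 4 * Real.pi ^ 2 * n ^ 3 * (2 * (k / l)) ^ 2 * (1 / s ^ 2) := by
        gcongr
    _ = 8 * Real.pi ^ 2 * n ^ 3 * (k / l) ^ 2 * (2 / s ^ 2) := by ring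
    _ ≤ _ := by gcongr
end

section
/- There exists a universal numeric constant c > 0 such that for every n ≥ 1, every orthotope R in ℝⁿ, and all integers k ≥ l ≥ 1, one has μ_k(R) ≥ (1/(c · n³)) · (k/l)^(2/n) · μ_l(R). -/
open MeasureTheory

/-- Half-open box with corners `α` and `β`. -/
def obox {n : ℕ} (α β : Fin n → ℝ) : Set (Fin n → ℝ) :=
  Set.univ.pi fun i => Set.Ioc (α i) (β i)

lemma obox_ae {n : ℕ} (α β : Fin n → ℝ) : obox α β =ᵐ[volume] Set.Icc α β :=
  Measure.univ_pi_Ioc_ae_eq_Icc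

lemma obox_meas {n : ℕ} (α β : Fin n → ℝ) : MeasurableSet (obox α β) :=
  MeasurableSet.univ_pi fun _ => measurableSet_Ioc

lemma obox_integrable {n : ℕ} (α β : Fin n → ℝ) {F : (Fin n → ℝ) → ℝ} (hF : Continuous F) :
    IntegrableOn F (obox α β) := by
  refine (hF.continuousOn.integrableOn_compact (isCompact_Icc (a := α) (b := β))).mono_set ?_
  intro x hx
  exact ⟨fun i => (hx i trivial).1.le, fun i => (hx i trivial).2⟩

lemma obox_volume {n : ℕ} (α β : Fin n → ℝ) (h : ∀ i, α i < β i) :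
    volume.real (obox α β) = ∏ i, (β i - α i) := by
  unfold obox Measure.real
  rw [volume_pi_pi, ENNReal.toReal_prod]
  refine Finset.prod_congr rfl fun i _ => ?_
  rw [Real.volume_Ioc, ENNReal.toReal_ofReal (by linarith [h i])]

lemma obox_param {n : ℕ} (α β : Fin n → ℝ) {F : ℝ → (Fin n → ℝ) → ℝ}
    (hF : Continuous (Function.uncurry F)) : Continuous fun t => ∫ y in obox α β, F t y := by
  have := continuous_parametric_integral_of_continuous (μ := volume) hF
    (isCompact_Icc (a := α) (b := β))
  convert this using 2 with t
  exact setIntegral_congr_set (obox_ae α β)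

lemma cons_continuous {n : ℕ} :
    Continuous (fun p : ℝ × (Fin n → ℝ) => (Fin.cons p.1 p.2 : Fin (n + 1) → ℝ)) := by
  refine continuous_pi fun i => ?_
  refine Fin.cases ?_ (fun j => ?_) i
  · simpa using continuous_fst
  · simp only [Fin.cons_succ]; fun_prop

lemma obox_fubini_aux {n : ℕ} (α β : Fin (n + 1) → ℝ) {F : (Fin (n + 1) → ℝ) → ℝ} :
    ∫ x in obox α β, F x = ∫ p in Set.Ioc (α 0) (β 0) ×ˢ
      obox (fun i => α i.succ) (fun i => β i.succ), F (Fin.cons p.1 p.2) := by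
  have h := (volume_preserving_piFinSuccAbove (fun _ : Fin (n + 1) => ℝ) 0).symm
  have h2 := h.setIntegral_preimage_emb (MeasurableEquiv.measurableEmbedding _) F (obox α β)
  rw [← h2]
  have e : (MeasurableEquiv.piFinSuccAbove (fun _ : Fin (n + 1) => ℝ) 0).symm ⁻¹' (obox α β) =
      Set.Ioc (α 0) (β 0) ×ˢ obox (fun i => α i.succ) (fun i => β i.succ) := by
    ext p
    simp only [obox, Set.mem_preimage, Set.mem_pi, Set.mem_univ, true_imp_iff, Set.mem_prod]
    rw [Fin.forall_fin_succ]
    rfl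
  rw [e]
  refine setIntegral_congr_fun (measurableSet_Ioc.prod (obox_meas _ _)) fun p _ => ?_
  simp [MeasurableEquiv.piFinSuccAbove, Fin.insertNthEquiv]

lemma prod_integrable {n : ℕ} (α β : Fin n → ℝ) (a b : ℝ) {F : ℝ × (Fin n → ℝ) → ℝ}
    (hF : Continuous F) :
    IntegrableOn F (Set.Ioc a b ×ˢ obox α β) (volume.prod volume) := by
  refine ContinuousOn.integrableOn_compact (μ := (volume : Measure (ℝ × (Fin n → ℝ))))
    ((isCompact_Icc (a := a) (b := b)).prod (isCompact_Icc (a := α) (b := β)))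
    hF.continuousOn |>.mono_set ?_
  rintro ⟨t, x⟩ ⟨ht, hx⟩
  exact ⟨⟨ht.1.le, ht.2⟩, fun i => (hx i trivial).1.le, fun i => (hx i trivial).2⟩

lemma obox_fubini {n : ℕ} (α β : Fin (n + 1) → ℝ) {F : (Fin (n + 1) → ℝ) → ℝ}
    (hF : Continuous F) :
    ∫ x in obox α β, F x = ∫ t in Set.Ioc (α 0) (β 0),
      ∫ y in obox (fun i => α i.succ) (fun i => β i.succ), F (Fin.cons t y) := by
  rw [obox_fubini_aux]
  exact setIntegral_prod _ (prod_integrable _ _ _ _ (hF.comp cons_continuous))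

lemma obox_fubini' {n : ℕ} (α β : Fin (n + 1) → ℝ) {F : (Fin (n + 1) → ℝ) → ℝ}
    (hF : Continuous F) :
    ∫ x in obox α β, F x = ∫ y in obox (fun i => α i.succ) (fun i => β i.succ),
      ∫ t in Set.Ioc (α 0) (β 0), F (Fin.cons t y) := by
  rw [obox_fubini α β hF]
  have := prod_integrable (fun i => α i.succ) (fun i => β i.succ) (α 0) (β 0)
    (hF.comp cons_continuous)
  rw [IntegrableOn, ← Measure.prod_restrict] at this
  exact integral_integral_swap this

lemma cs_ineq {X : Type*} [MeasurableSpace X] (μ : Measure X) [IsFiniteMeasure μ] {f : X → ℝ}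
    (hf : Integrable f μ) (hf2 : Integrable (fun x => f x ^ 2) μ) :
    (∫ x, f x ∂μ) ^ 2 ≤ μ.real Set.univ * ∫ x, f x ^ 2 ∂μ := by
  set M := μ.real Set.univ with hM
  set A := ∫ x, f x ∂μ with hA
  have hM0 : 0 ≤ M := measureReal_nonneg
  rcases hM0.eq_or_lt with h0 | h0
  · have : μ = 0 := by
      rw [← Measure.measure_univ_eq_zero]
      exact (measureReal_eq_zero_iff).1 (hM ▸ h0.symm)
    rw [hA, ← h0, this]; simp
  · have h1 : 0 ≤ ∫ x, (M * f x - A) ^ 2 ∂μ := integral_nonneg fun x => sq_nonneg _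
    have h2 : ∫ x, (M * f x - A) ^ 2 ∂μ = M ^ 2 * (∫ x, f x ^ 2 ∂μ) - 2 * M * A * A + A ^ 2 * M := by
      have : ∀ x, (M * f x - A) ^ 2 = M ^ 2 * f x ^ 2 - 2 * M * A * f x + A ^ 2 := fun x => by ring
      simp_rw [this]
      have hi1 : Integrable (fun x => M ^ 2 * f x ^ 2 - 2 * M * A * f x) μ :=
        (hf2.const_mul _).sub (hf.const_mul _)
      rw [integral_add hi1 (integrable_const _),
        integral_sub (hf2.const_mul _) (hf.const_mul _), integral_const_mul, integral_const_mul,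
        integral_const, smul_eq_mul]
      ring
    rw [h2] at h1
    have h3 : 0 ≤ M * (M * (∫ x, f x ^ 2 ∂μ) - A ^ 2) := by linarith
    have := nonneg_of_mul_nonneg_right h3 h0
    linarith

lemma oscillation_ineq {a b D : ℝ} (hab : a < b) {h : ℝ → ℝ} (hc : Continuous h)
    (hD : ∀ t ∈ Set.Ioc a b, ∀ u ∈ Set.Ioc a b, (h t - h u) ^ 2 ≤ D) :
    ∫ t in Set.Ioc a b, h t ^ 2 ≤
      (b - a)⁻¹ * (∫ t in Set.Ioc a b, h t) ^ 2 + (b - a) * D := by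
  have hint : ∀ {F : ℝ → ℝ}, Continuous F → IntegrableOn F (Set.Ioc a b) := fun hF =>
    (hF.continuousOn.integrableOn_compact isCompact_Icc).mono_set Set.Ioc_subset_Icc_self
  set A := ∫ t in Set.Ioc a b, h t with hA
  have hL : 0 < b - a := by linarith
  have hvol : (volume.restrict (Set.Ioc a b)).real Set.univ = b - a := by
    simp [hab.le]
  have hbound : ∀ t ∈ Set.Ioc a b, (h t - (b - a)⁻¹ * A) ^ 2 ≤ D := by
    intro t ht
    have h1 := cs_ineq (volume.restrict (Set.Ioc a b)) (f := fun u => h t - h u)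
      (hint (by fun_prop)) (hint (by fun_prop))
    rw [integral_sub (hint continuous_const) (hint hc), integral_const, hvol, smul_eq_mul] at h1
    have h2 : ∫ u in Set.Ioc a b, (h t - h u) ^ 2 ≤ ∫ u in Set.Ioc a b, D :=
      setIntegral_mono_on (hint (by fun_prop)) (hint continuous_const) measurableSet_Ioc
        fun u hu => hD t ht u hu
    rw [integral_const, hvol, smul_eq_mul] at h2
    have h3 : ((b - a) * h t - A) ^ 2 ≤ (b - a) * ((b - a) * D) :=
      h1.trans (mul_le_mul_of_nonneg_left h2 hL.le)
    have h4 : (b - a) * h t - A = (b - a) * (h t - (b - a)⁻¹ * A) := by field_simp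
    rw [h4, mul_pow] at h3
    have : 0 < (b - a) ^ 2 := by positivity
    nlinarith
  have h5 : ∫ t in Set.Ioc a b, (h t - (b - a)⁻¹ * A) ^ 2 ≤ ∫ u in Set.Ioc a b, D :=
    setIntegral_mono_on (hint (by fun_prop)) (hint continuous_const) measurableSet_Ioc hbound
  rw [integral_const, hvol, smul_eq_mul] at h5
  have h6 : ∫ t in Set.Ioc a b, (h t - (b - a)⁻¹ * A) ^ 2 =
      (∫ t in Set.Ioc a b, h t ^ 2) - (b - a)⁻¹ * A ^ 2 := by
    have : ∀ x, (h x - (b - a)⁻¹ * A) ^ 2 =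
      h x ^ 2 - 2 * ((b - a)⁻¹ * A) * h x + ((b - a)⁻¹ * A) ^ 2 := fun x => by ring
    simp_rw [this]
    rw [integral_add (hint (by fun_prop)) (hint continuous_const),
      integral_sub (hint (by fun_prop)) (hint (by fun_prop)), integral_const_mul,
      integral_const, hvol, smul_eq_mul, ← hA]
    field_simp
    ring
  linarith

lemma diff_sq_le {a b : ℝ} {f f' : ℝ → ℝ} (hd : ∀ x, HasDerivAt f (f' x) x)
    (hc : Continuous f') {t u : ℝ} (ht : t ∈ Set.Ioc a b) (hu : u ∈ Set.Ioc a b) :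
    (f t - f u) ^ 2 ≤ (b - a) * ∫ x in Set.Ioc a b, f' x ^ 2 := by
  wlog h : u ≤ t generalizing t u
  · have := this hu ht (by linarith)
    nlinarith
  have hint : ∀ {F : ℝ → ℝ}, Continuous F → ∀ c d, IntegrableOn F (Set.Ioc c d) := fun hF c d =>
    (hF.continuousOn.integrableOn_compact isCompact_Icc).mono_set Set.Ioc_subset_Icc_self
  have h1 : ∫ x in u..t, f' x = f t - f u :=
    intervalIntegral.integral_eq_sub_of_hasDerivAt (fun x _ => hd x) (hc.intervalIntegrable _ _)
  rw [intervalIntegral.integral_of_le h] at h1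
  have h2 := cs_ineq (volume.restrict (Set.Ioc u t)) (f := f') (hint hc _ _)
    (hint (hc.pow 2) _ _)
  have hvol : (volume.restrict (Set.Ioc u t)).real Set.univ = t - u := by
    simp [h]
  rw [h1, hvol] at h2
  have h3 : ∫ x in Set.Ioc u t, f' x ^ 2 ≤ ∫ x in Set.Ioc a b, f' x ^ 2 :=
    setIntegral_mono_set (hint (hc.pow 2) _ _) (Filter.Eventually.of_forall fun x => sq_nonneg _)
      (Filter.Eventually.of_forall (Set.Ioc_subset_Ioc hu.1.le ht.2))
  have h4 : 0 ≤ ∫ x in Set.Ioc u t, f' x ^ 2 := integral_nonneg fun x => sq_nonneg _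
  refine h2.trans (mul_le_mul ?_ h3 h4 ?_) <;> linarith [ht.2, hu.1, ht.1]

/-- Poincaré inequality on a box. -/
theorem box_poincare (s : ℝ) (n : ℕ) : ∀ (α β : Fin n → ℝ) (_ : ∀ i, α i < β i)
    (_ : ∀ i, β i - α i ≤ s) (g : (Fin n → ℝ) → ℝ) (G : Fin n → (Fin n → ℝ) → ℝ)
    (_ : Continuous g) (_ : ∀ i, Continuous (G i))
    (_ : ∀ i x, HasDerivAt (fun τ => g (Function.update x i τ)) (G i x) (x i)),
    ∫ x in obox α β, g x ^ 2 ≤ (∏ i, (β i - α i))⁻¹ * (∫ x in obox α β, g x) ^ 2 +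
      s ^ 2 * ∑ i, ∫ x in obox α β, G i x ^ 2 := by
  induction n with
  | zero =>
    intro α β _ _ g G _ _ _
    have : obox α β = Set.univ := by ext; simp [obox]
    rw [this]
    simp [Measure.volume_pi_eq_dirac (0 : Fin 0 → ℝ)]
  | succ n ih =>
    intro α β hαβ hs g G hg hG hd
    set α' : Fin n → ℝ := fun i => α i.succ with hα'
    set β' : Fin n → ℝ := fun i => β i.succ with hβ'
    set M' := ∏ i, (β' i - α' i) with hM'
    have hM'0 : 0 < M' := Finset.prod_pos fun i _ => sub_pos.2 (hαβ _)
    have hI : 0 < β 0 - α 0 := sub_pos.2 (hαβ 0)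
    have hcy : ∀ t : ℝ, Continuous fun y : Fin n → ℝ => (Fin.cons t y : Fin (n + 1) → ℝ) :=
      fun t => cons_continuous.comp (Continuous.prodMk_right t)
    have hct : ∀ y : Fin n → ℝ, Continuous fun t : ℝ => (Fin.cons t y : Fin (n + 1) → ℝ) :=
      fun y => cons_continuous.comp (Continuous.prodMk_left y)
    set h : ℝ → ℝ := fun t => ∫ y in obox α' β', g (Fin.cons t y) with hh
    have hhc : Continuous h := obox_param _ _ (hg.comp cons_continuous)
    have hint : ∀ {F : ℝ → ℝ}, Continuous F → ∀ c d, IntegrableOn F (Set.Ioc c d) :=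
      fun hF c d => (hF.continuousOn.integrableOn_compact isCompact_Icc).mono_set
        Set.Ioc_subset_Icc_self
    have hIH : ∀ t, ∫ y in obox α' β', g (Fin.cons t y) ^ 2 ≤ M'⁻¹ * h t ^ 2 +
        s ^ 2 * ∑ i : Fin n, ∫ y in obox α' β', G i.succ (Fin.cons t y) ^ 2 := by
      intro t
      refine ih α' β' (fun i => hαβ _) (fun i => hs _) (fun y => g (Fin.cons t y))
        (fun i y => G i.succ (Fin.cons t y)) (hg.comp (hcy t))
        (fun i => (hG _).comp (hcy t)) (fun i y => ?_)
      have := hd i.succ (Fin.cons t y)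
      simpa [Fin.cons_update] using this
    have hcG : ∀ i : Fin n, Continuous fun t =>
        ∫ y in obox α' β', G i.succ (Fin.cons t y) ^ 2 := fun i =>
      obox_param _ _ (((hG i.succ).comp cons_continuous).pow 2)
    have step1 : ∫ x in obox α β, g x ^ 2 ≤ M'⁻¹ * (∫ t in Set.Ioc (α 0) (β 0), h t ^ 2) +
        s ^ 2 * ∑ i : Fin n, ∫ x in obox α β, G i.succ x ^ 2 := by
      rw [obox_fubini α β (F := fun x => g x ^ 2) (hg.pow 2)]
      have e : ∀ i : Fin n, ∫ x in obox α β, G i.succ x ^ 2 = ∫ t in Set.Ioc (α 0) (β 0),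
        ∫ y in obox α' β', G i.succ (Fin.cons t y) ^ 2 := fun i =>
        obox_fubini α β ((hG i.succ).pow 2)
      simp_rw [e]
      rw [← integral_finsetSum _ (fun i _ => hint (hcG i) _ _), ← integral_const_mul,
        ← integral_const_mul, ← integral_add (hint (by fun_prop) _ _) (hint (by fun_prop) _ _)]
      exact integral_mono (hint (obox_param _ _ ((hg.comp cons_continuous).pow 2)) _ _)
        (hint (by fun_prop) _ _) hIH
    set D := M' * ((β 0 - α 0) * ∫ x in obox α β, G 0 x ^ 2) with hDdef
    have hD : ∀ t ∈ Set.Ioc (α 0) (β 0), ∀ u ∈ Set.Ioc (α 0) (β 0), (h t - h u) ^ 2 ≤ D := by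
      intro t ht u hu
      have hgt := hg.comp (hcy t)
      have hgu := hg.comp (hcy u)
      have e1 : h t - h u = ∫ y in obox α' β', (g (Fin.cons t y) - g (Fin.cons u y)) :=
        (integral_sub (obox_integrable _ _ hgt) (obox_integrable _ _ hgu)).symm
      have : IsFiniteMeasure (volume.restrict (obox α' β')) := by
        constructor
        rw [Measure.restrict_apply_univ, measure_congr (obox_ae α' β')]
        exact isCompact_Icc.measure_lt_top
      have e2 := cs_ineq (volume.restrict (obox α' β'))
        (f := fun y => g (Fin.cons t y) - g (Fin.cons u y))
        (obox_integrable _ _ (hgt.sub hgu)) (obox_integrable _ _ ((hgt.sub hgu).pow 2))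
      have hvol : (volume.restrict (obox α' β')).real Set.univ = M' := by
        rw [measureReal_restrict_apply_univ]
        exact obox_volume _ _ fun i => hαβ _
      rw [e1]
      refine e2.trans ?_
      rw [hvol, hDdef]
      refine mul_le_mul_of_nonneg_left ?_ hM'0.le
      rw [obox_fubini' α β (F := fun x => G 0 x ^ 2) ((hG 0).pow 2), ← integral_const_mul]
      have hcI : Continuous fun y : Fin n → ℝ =>
          ∫ t in Set.Ioc (α 0) (β 0), G 0 (Fin.cons t y) ^ 2 := by
        have := continuous_parametric_integral_of_continuous (μ := (volume : Measure ℝ))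
          (f := fun (y : Fin n → ℝ) (t : ℝ) => G 0 (Fin.cons t y) ^ 2)
          (show Continuous fun p : (Fin n → ℝ) × ℝ => G 0 (Fin.cons p.2 p.1) ^ 2 from
            ((hG 0).comp (cons_continuous.comp continuous_swap)).pow 2)
          (isCompact_Icc (a := α 0) (b := β 0))
        convert this using 2 with y
        exact integral_Icc_eq_integral_Ioc.symm
      refine integral_mono (obox_integrable _ _ ((hgt.sub hgu).pow 2))
        (obox_integrable _ _ (hcI.const_mul _)) fun y => ?_
      refine diff_sq_le (f := fun t => g (Fin.cons t y)) (f' := fun t => G 0 (Fin.cons t y))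
        (fun x => ?_) ((hG 0).comp (hct y)) ht hu
      have := hd 0 (Fin.cons x y)
      simpa using this
    have step2 := oscillation_ineq (hαβ 0) hhc hD
    have e3 : ∫ x in obox α β, g x = ∫ t in Set.Ioc (α 0) (β 0), h t := obox_fubini α β hg
    rw [Fin.prod_univ_succ, Fin.sum_univ_succ, e3]
    have h7 : M'⁻¹ * ∫ t in Set.Ioc (α 0) (β 0), h t ^ 2 ≤
        M'⁻¹ * ((β 0 - α 0)⁻¹ * (∫ t in Set.Ioc (α 0) (β 0), h t) ^ 2 + (β 0 - α 0) * D) :=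
      mul_le_mul_of_nonneg_left step2 (by positivity)
    have h8 : M'⁻¹ * ((β 0 - α 0) * D) = (β 0 - α 0) ^ 2 * ∫ x in obox α β, G 0 x ^ 2 := by
      rw [hDdef]; field_simp
    have h9 : (β 0 - α 0) ^ 2 * ∫ x in obox α β, G 0 x ^ 2 ≤
        s ^ 2 * ∫ x in obox α β, G 0 x ^ 2 :=
      mul_le_mul_of_nonneg_right (pow_le_pow_left₀ hI.le (hs 0) 2)
        (integral_nonneg fun x => sq_nonneg _)
    change _ ≤ ((β 0 - α 0) * M')⁻¹ * _ + _
    rw [mul_inv]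
    rw [mul_add, h8] at h7
    rw [mul_add]
    linarith [step1]

/-- The grid cells. -/
def gcell {n : ℕ} (L : Fin n → ℝ) (p : Fin n → ℕ) (j : (i : Fin n) → Fin (p i)) :
    Set (Fin n → ℝ) :=
  obox (fun i => ((j i : ℕ) : ℝ) * (L i / p i)) (fun i => (((j i : ℕ) : ℝ) + 1) * (L i / p i))

lemma mem_Ioc_cell {δ x : ℝ} (hδ : 0 < δ) (j : ℕ) :
    x ∈ Set.Ioc ((j : ℝ) * δ) (((j : ℝ) + 1) * δ) ↔ ⌈x / δ⌉ = (j : ℤ) + 1 := by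
  rw [Int.ceil_eq_iff, Set.mem_Ioc, lt_div_iff₀ hδ, div_le_iff₀ hδ]
  push_cast
  simp

lemma gcell_iUnion {n : ℕ} (L : Fin n → ℝ) (hL : ∀ i, 0 < L i) (p : Fin n → ℕ)
    (hp : ∀ i, 0 < p i) : obox 0 L = ⋃ j, gcell L p j := by
  have hδ : ∀ i, 0 < L i / p i := fun i => div_pos (hL i) (by exact_mod_cast hp i)
  ext x
  simp only [Set.mem_iUnion, gcell, obox, Set.mem_pi, Set.mem_univ, true_imp_iff]
  constructor
  · intro hx
    have : ∀ i, ∃ j : Fin (p i), x i ∈ Set.Ioc (((j : ℕ) : ℝ) * (L i / p i))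
        ((((j : ℕ) : ℝ) + 1) * (L i / p i)) := by
      intro i
      have h0 : 0 < x i / (L i / p i) := div_pos (hx i).1 (hδ i)
      have hpi : (0 : ℝ) < p i := by exact_mod_cast hp i
      have h1 : x i / (L i / p i) ≤ p i := by
        rw [div_le_iff₀ (hδ i)]
        have : (p i : ℝ) * (L i / p i) = L i := by field_simp
        rw [this]; exact (hx i).2
      have h2 : 0 < ⌈x i / (L i / p i)⌉ := Int.ceil_pos.2 h0
      have h3 : ⌈x i / (L i / p i)⌉ ≤ p i := Int.ceil_le.2 (by exact_mod_cast h1)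
      refine ⟨⟨(⌈x i / (L i / p i)⌉ - 1).toNat, by omega⟩, ?_⟩
      rw [mem_Ioc_cell (hδ i)]
      simp only
      omega
    choose j hj using this
    exact ⟨j, hj⟩
  · rintro ⟨j, hj⟩ i
    have hpi : (0 : ℝ) < p i := by exact_mod_cast hp i
    refine ⟨lt_of_le_of_lt ?_ (hj i).1, (hj i).2.trans ?_⟩
    · have := hδ i
      simp only [Pi.zero_apply]; positivity
    · have h1 : ((j i : ℕ) : ℝ) + 1 ≤ p i := by exact_mod_cast (j i).2
      calc _ ≤ (p i : ℝ) * (L i / p i) := mul_le_mul_of_nonneg_right h1 (hδ i).le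
        _ = L i := by field_simp

lemma gcell_disjoint {n : ℕ} (L : Fin n → ℝ) (hL : ∀ i, 0 < L i) (p : Fin n → ℕ)
    (hp : ∀ i, 0 < p i) : Pairwise (Function.onFun Disjoint (gcell L p)) := by
  have hδ : ∀ i, 0 < L i / p i := fun i => div_pos (hL i) (by exact_mod_cast hp i)
  intro j j' hne
  refine Set.disjoint_left.2 fun x hx hx' => hne ?_
  funext i
  have h1 := (mem_Ioc_cell (hδ i) _).1 (hx i trivial)
  have h2 := (mem_Ioc_cell (hδ i) _).1 (hx' i trivial)
  apply Fin.ext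
  omega

lemma gcell_sum {n : ℕ} (L : Fin n → ℝ) (hL : ∀ i, 0 < L i) (p : Fin n → ℕ)
    (hp : ∀ i, 0 < p i) {F : (Fin n → ℝ) → ℝ} (hF : Continuous F) :
    ∫ x in obox 0 L, F x = ∑ j, ∫ x in gcell L p j, F x := by
  rw [gcell_iUnion L hL p hp]
  exact integral_iUnion_fintype (fun j => obox_meas _ _) (gcell_disjoint L hL p hp)
    fun j => obox_integrable _ _ hF

theorem grid_poincare {n : ℕ} (L : Fin n → ℝ) (hL : ∀ i, 0 < L i) (p : Fin n → ℕ)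
    (hp : ∀ i, 0 < p i) (s : ℝ) (hs : ∀ i, L i / p i ≤ s)
    (g : (Fin n → ℝ) → ℝ) (G : Fin n → (Fin n → ℝ) → ℝ)
    (hg : Continuous g) (hG : ∀ i, Continuous (G i))
    (hd : ∀ i x, HasDerivAt (fun τ => g (Function.update x i τ)) (G i x) (x i))
    (h0 : ∀ j, ∫ x in gcell L p j, g x = 0) :
    ∫ x in obox 0 L, g x ^ 2 ≤ s ^ 2 * ∑ i, ∫ x in obox 0 L, G i x ^ 2 := by
  have hδ : ∀ i, 0 < L i / p i := fun i => div_pos (hL i) (by exact_mod_cast hp i)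
  rw [gcell_sum L hL p hp (F := fun x => g x ^ 2) (hg.pow 2)]
  have e : ∀ i, ∫ x in obox 0 L, G i x ^ 2 = ∑ j, ∫ x in gcell L p j, G i x ^ 2 := fun i =>
    gcell_sum L hL p hp (F := fun x => G i x ^ 2) ((hG i).pow 2)
  simp_rw [e]
  rw [Finset.sum_comm, Finset.mul_sum]
  refine Finset.sum_le_sum fun j _ => ?_
  have := box_poincare s n (fun i => ((j i : ℕ) : ℝ) * (L i / p i))
    (fun i => (((j i : ℕ) : ℝ) + 1) * (L i / p i)) (fun i => by nlinarith [hδ i])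
    (fun i => by nlinarith [hs i]) g G hg hG hd
  have h1 := h0 j
  unfold gcell at h1 ⊢
  rw [h1] at this
  simpa using this

/-- The parametrisation of an orthotope. -/
noncomputable def bmap {n : ℕ} (A : EuclideanSpace ℝ (Fin n) ≃ₗᵢ[ℝ] EuclideanSpace ℝ (Fin n))
    (b : EuclideanSpace ℝ (Fin n)) (y : Fin n → ℝ) : EuclideanSpace ℝ (Fin n) :=
  A (WithLp.toLp 2 y) + b

section transfer
variable {n : ℕ} (A : EuclideanSpace ℝ (Fin n) ≃ₗᵢ[ℝ] EuclideanSpace ℝ (Fin n))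
    (b : EuclideanSpace ℝ (Fin n))

lemma bmap_continuous : Continuous (bmap A b) := by
  unfold bmap
  have := PiLp.continuous_toLp 2 (fun _ : Fin n => ℝ)
  fun_prop

lemma bmap_injective : Function.Injective (bmap A b) := by
  intro x y h
  have := A.injective (add_right_cancel h)
  simpa using this

lemma bmap_preserving : MeasurePreserving (bmap A b) volume volume :=
  (measurePreserving_add_right volume b).comp
    (A.measurePreserving.comp (PiLp.volume_preserving_toLp (Fin n)))

lemma bmap_integral (L : Fin n → ℝ) (F : EuclideanSpace ℝ (Fin n) → ℝ) :
    ∫ x in bmap A b '' Set.Icc 0 L, F x = ∫ y in obox 0 L, F (bmap A b y) := by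
  have h := (bmap_preserving A b).setIntegral_preimage_emb
    ((bmap_continuous A b).measurableEmbedding (bmap_injective A b)) F (bmap A b '' Set.Icc 0 L)
  rw [← h, (bmap_injective A b).preimage_image]
  exact (setIntegral_congr_set (obox_ae 0 L)).symm

lemma orthotope_bmap {R : Set (EuclideanSpace ℝ (Fin n))} (hR : IsOrthotope n R) :
    ∃ (A : EuclideanSpace ℝ (Fin n) ≃ₗᵢ[ℝ] EuclideanSpace ℝ (Fin n))
      (b : EuclideanSpace ℝ (Fin n)) (L : Fin n → ℝ), (∀ i, 0 < L i) ∧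
      R = bmap A b '' Set.Icc 0 L := by
  obtain ⟨T, a, ha, rfl⟩ := hR
  refine ⟨T.toRealLinearIsometryEquiv, T 0 - T.toRealLinearIsometryEquiv (WithLp.toLp 2 a),
    fun i => 2 * a i, fun i => by linarith [ha i], ?_⟩
  have key : ∀ x, T x = bmap T.toRealLinearIsometryEquiv
      (T 0 - T.toRealLinearIsometryEquiv (WithLp.toLp 2 a)) (fun i => x i + a i) := by
    intro x
    have : WithLp.toLp 2 (fun i => x i + a i) = x + WithLp.toLp 2 a := by
      ext i; simp
    unfold bmap
    rw [this, map_add, IsometryEquiv.toRealLinearIsometryEquiv_apply]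
    abel
  ext z
  constructor
  · rintro ⟨x, hx, rfl⟩
    refine ⟨fun i => x i + a i, ⟨fun i => ?_, fun i => ?_⟩, (key x).symm⟩
    · have := (abs_le.1 (hx i)).1
      simp only [Pi.zero_apply]; linarith
    · have := (abs_le.1 (hx i)).2
      simp only; linarith
  · rintro ⟨y, hy, rfl⟩
    refine ⟨WithLp.toLp 2 fun i => y i - a i, fun i => ?_, ?_⟩
    · have h1 := hy.1 i
      have h2 := hy.2 i
      simp only [Pi.zero_apply] at h1 h2 ⊢
      rw [abs_le]; constructor <;> linarith
    · rw [key]; simp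

/-- Directional derivatives along the axes of the orthotope. -/
noncomputable def pdir (f : EuclideanSpace ℝ (Fin n) → ℝ) (i : Fin n) (y : Fin n → ℝ) : ℝ :=
  fderiv ℝ f (bmap A b y) (A (WithLp.toLp 2 (Pi.single i 1)))

lemma norm_fderiv_sq (ℓ : EuclideanSpace ℝ (Fin n) →L[ℝ] ℝ) :
    ‖ℓ‖ ^ 2 = ∑ i, ℓ (A (WithLp.toLp 2 (Pi.single i 1))) ^ 2 := by
  have h := ((EuclideanSpace.basisFun (Fin n) ℝ).map A).sum_sq_norm_inner_right
    ((InnerProductSpace.toDual ℝ _).symm ℓ)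
  rw [LinearIsometryEquiv.norm_map] at h
  rw [← h]
  refine Finset.sum_congr rfl fun i _ => ?_
  rw [real_inner_comm, InnerProductSpace.toDual_symm_apply, Real.norm_eq_abs, sq_abs]
  simp [EuclideanSpace.basisFun_apply]

lemma bmap_hasDerivAt {f : EuclideanSpace ℝ (Fin n) → ℝ} (hf : ContDiff ℝ (⊤ : ℕ∞) f)
    (i : Fin n) (y : Fin n → ℝ) :
    HasDerivAt (fun τ => f (bmap A b (Function.update y i τ))) (pdir A b f i y) (y i) := by
  have h1 : HasDerivAt (fun τ => bmap A b (Function.update y i τ))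
      (A (WithLp.toLp 2 (Pi.single i 1))) (y i) := by
    have e : ∀ τ, bmap A b (Function.update y i τ) =
        bmap A b y + (τ - y i) • A (WithLp.toLp 2 (Pi.single i 1)) := by
      intro τ
      have : WithLp.toLp 2 (Function.update y i τ) =
        WithLp.toLp 2 y + (τ - y i) • WithLp.toLp 2 (Pi.single i (1 : ℝ)) := by
        ext j
        by_cases h : j = i
        · subst h; simp
        · simp [h]
      unfold bmap
      rw [this, map_add, map_smul]
      abel
    simp_rw [e]
    have := (((hasDerivAt_id (y i)).sub_const (y i)).smul_const
      (A (WithLp.toLp 2 (Pi.single i (1 : ℝ))))).const_add (bmap A b y)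
    simpa using this
  have h2 : HasFDerivAt f (fderiv ℝ f (bmap A b (Function.update y i (y i))))
      (bmap A b (Function.update y i (y i))) :=
    (hf.differentiable (by simp)).differentiableAt.hasFDerivAt
  have h3 := h2.comp_hasDerivAt (y i) h1
  rw [Function.update_eq_self] at h3
  exact h3

lemma pdir_continuous {f : EuclideanSpace ℝ (Fin n) → ℝ} (hf : ContDiff ℝ (⊤ : ℕ∞) f)
    (i : Fin n) : Continuous (pdir A b f i) := by
  have h1 : Continuous (fderiv ℝ f) := hf.continuous_fderiv (by simp)
  exact (h1.comp (bmap_continuous A b)).clm_apply continuous_const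

lemma num_eq {f : EuclideanSpace ℝ (Fin n) → ℝ} (hf : ContDiff ℝ (⊤ : ℕ∞) f) (L : Fin n → ℝ) :
    ∫ x in bmap A b '' Set.Icc 0 L, ‖fderiv ℝ f x‖ ^ 2 =
      ∑ i, ∫ y in obox 0 L, pdir A b f i y ^ 2 := by
  rw [bmap_integral]
  simp_rw [norm_fderiv_sq A]
  exact integral_finsetSum _ fun i _ => obox_integrable _ _ ((pdir_continuous A b hf i).pow 2)

lemma Icc_subset_closure (L : Fin n → ℝ) (hL : ∀ i, 0 < L i) :
    Set.Icc 0 L ⊆ closure (interior (Set.Icc 0 L)) := by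
  have hne : (interior (Set.Icc 0 L)).Nonempty := by
    refine ⟨fun i => L i / 2, ?_⟩
    have ho : IsOpen (Set.univ.pi fun i => Set.Ioo 0 (L i)) :=
      isOpen_set_pi Set.finite_univ fun i _ => isOpen_Ioo
    refine interior_maximal ?_ ho ?_
    · intro x hx
      exact ⟨fun i => (hx i trivial).1.le, fun i => (hx i trivial).2.le⟩
    · intro i _
      constructor <;> simp only <;> linarith [hL i]
  rw [(convex_Icc (𝕜 := ℝ) (0 : Fin n → ℝ) L).closure_interior_eq_closure_of_nonempty_interior hne]
  exact subset_closure

lemma den_pos {f : EuclideanSpace ℝ (Fin n) → ℝ} (hf : Continuous f) (L : Fin n → ℝ)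
    (hL : ∀ i, 0 < L i) {x : EuclideanSpace ℝ (Fin n)} (hx : x ∈ bmap A b '' Set.Icc 0 L)
    (hfx : f x ≠ 0) : 0 < ∫ x in bmap A b '' Set.Icc 0 L, f x ^ 2 := by
  have hnn : 0 ≤ ∫ x in bmap A b '' Set.Icc 0 L, f x ^ 2 := integral_nonneg fun x => sq_nonneg _
  refine lt_of_le_of_ne hnn fun h => hfx ?_
  obtain ⟨y, hy, rfl⟩ := hx
  have hg : Continuous fun y => f (bmap A b y) ^ 2 := (hf.comp (bmap_continuous A b)).pow 2
  rw [bmap_integral, setIntegral_congr_set (obox_ae 0 L)] at h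
  have h2 := (integral_eq_zero_iff_of_nonneg (fun y => sq_nonneg (f (bmap A b y)))
    (hg.continuousOn.integrableOn_compact isCompact_Icc)).1 h.symm
  have h3 := Measure.eqOn_of_ae_eq h2 hg.continuousOn continuousOn_const
    (Icc_subset_closure L hL) hy
  simpa using h3

end transfer

/-- Rayleigh quotient. -/
noncomputable def rayl {n : ℕ} (R : Set (EuclideanSpace ℝ (Fin n)))
    (f : EuclideanSpace ℝ (Fin n) → ℝ) : ℝ :=
  (∫ x in R, ‖fderiv ℝ f x‖ ^ 2) / ∫ x in R, (f x) ^ 2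

lemma rayl_smul {n : ℕ} (R : Set (EuclideanSpace ℝ (Fin n)))
    (f : EuclideanSpace ℝ (Fin n) → ℝ) (t : ℝ) (ht : t ≠ 0) : rayl R (t • f) = rayl R f := by
  unfold rayl
  have h1 : ∀ x, ‖fderiv ℝ (t • f) x‖ ^ 2 = t ^ 2 * ‖fderiv ℝ f x‖ ^ 2 := by
    intro x
    rw [fderiv_const_smul_field, Pi.smul_apply, norm_smul, mul_pow, Real.norm_eq_abs, sq_abs]
  have h2 : ∀ x, ((t • f) x) ^ 2 = t ^ 2 * (f x) ^ 2 := by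
    intro x
    rw [Pi.smul_apply, smul_eq_mul, mul_pow]
  simp_rw [h1, h2]
  rw [integral_const_mul, integral_const_mul, mul_div_mul_left _ _ (pow_ne_zero 2 ht)]

lemma rayl_bdd {n : ℕ} (R : Set (EuclideanSpace ℝ (Fin n))) (hR : IsCompact R)
    (V : Submodule ℝ (EuclideanSpace ℝ (Fin n) → ℝ)) [FiniteDimensional ℝ V]
    (hV : ∀ f ∈ V, ContDiff ℝ (⊤ : ℕ∞) f)
    (hpos : ∀ f ∈ V, f ≠ 0 → 0 < ∫ x in R, (f x) ^ 2) :
    ∃ M, ∀ f ∈ V, f ≠ 0 → rayl R f ≤ M := by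
  set bs := Module.finBasis ℝ V with hbs
  have hval : ∀ (c : Fin (Module.finrank ℝ V) → ℝ),
      ((bs.equivFun.symm c : V) : EuclideanSpace ℝ (Fin n) → ℝ) =
        fun x => ∑ i, c i * (bs i : EuclideanSpace ℝ (Fin n) → ℝ) x := by
    intro c
    rw [Module.Basis.equivFun_symm_apply]
    ext x
    simp
  have hsm : ∀ i, ContDiff ℝ (⊤ : ℕ∞) (bs i : EuclideanSpace ℝ (Fin n) → ℝ) :=
    fun i => hV _ (bs i).2
  have hder : ∀ (c : Fin (Module.finrank ℝ V) → ℝ) x,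
      fderiv ℝ ((bs.equivFun.symm c : V) : EuclideanSpace ℝ (Fin n) → ℝ) x =
        ∑ i, c i • fderiv ℝ (bs i : EuclideanSpace ℝ (Fin n) → ℝ) x := by
    intro c x
    rw [hval]
    refine HasFDerivAt.fderiv (HasFDerivAt.fun_sum fun i _ => ?_)
    exact (((hsm i).differentiable (by simp)).differentiableAt.hasFDerivAt).const_mul (c i)
  have hnum : Continuous fun c : Fin (Module.finrank ℝ V) → ℝ =>
      ∫ x in R, ‖fderiv ℝ ((bs.equivFun.symm c : V) : EuclideanSpace ℝ (Fin n) → ℝ) x‖ ^ 2 := by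
    refine continuous_parametric_integral_of_continuous ?_ hR
    simp_rw [hder]
    have h1 : ∀ i, Continuous (fderiv ℝ (bs i : EuclideanSpace ℝ (Fin n) → ℝ)) :=
      fun i => (hsm i).continuous_fderiv (by simp)
    unfold Function.uncurry
    fun_prop
  have hden : Continuous fun c : Fin (Module.finrank ℝ V) → ℝ =>
      ∫ x in R, ((bs.equivFun.symm c : V) : EuclideanSpace ℝ (Fin n) → ℝ) x ^ 2 := by
    refine continuous_parametric_integral_of_continuous ?_ hR
    simp_rw [hval]
    have h1 : ∀ i, Continuous (bs i : EuclideanSpace ℝ (Fin n) → ℝ) :=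
      fun i => (hsm i).continuous
    unfold Function.uncurry
    fun_prop
  have hne : ∀ c : Fin (Module.finrank ℝ V) → ℝ, c ≠ 0 →
      ((bs.equivFun.symm c : V) : EuclideanSpace ℝ (Fin n) → ℝ) ≠ 0 := by
    intro c hc h
    apply hc
    have : bs.equivFun.symm c = 0 := Subtype.ext h
    exact bs.equivFun.symm.map_eq_zero_iff.1 this
  have hcomp := isCompact_sphere (0 : Fin (Module.finrank ℝ V) → ℝ) 1
  have hcont : ContinuousOn (fun c : Fin (Module.finrank ℝ V) → ℝ =>
      rayl R ((bs.equivFun.symm c : V) : EuclideanSpace ℝ (Fin n) → ℝ))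
      (Metric.sphere (0 : Fin (Module.finrank ℝ V) → ℝ) 1) := by
    refine hnum.continuousOn.div hden.continuousOn fun c hc => ?_
    refine (hpos _ (Subtype.prop _) (hne c ?_)).ne'
    exact ne_zero_of_mem_unit_sphere ⟨c, hc⟩
  obtain ⟨M, hM⟩ := hcomp.bddAbove_image hcont
  refine ⟨M, fun f hf hf0 => ?_⟩
  set c := bs.equivFun ⟨f, hf⟩ with hc
  have hc0 : c ≠ 0 := by
    intro h
    have := bs.equivFun.map_eq_zero_iff.1 h
    exact hf0 (congrArg Subtype.val this)
  have hn : ‖c‖ ≠ 0 := norm_ne_zero_iff.2 hc0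
  have h1 : rayl R ((bs.equivFun.symm (‖c‖⁻¹ • c) : V) : EuclideanSpace ℝ (Fin n) → ℝ) ≤ M := by
    refine hM ⟨_, ?_, rfl⟩
    rw [mem_sphere_zero_iff_norm, norm_smul, norm_inv, norm_norm, inv_mul_cancel₀ hn]
  rw [map_smul, hc, LinearEquiv.symm_apply_apply] at h1
  rw [Submodule.coe_smul, rayl_smul _ _ _ (inv_ne_zero hn)] at h1
  exact h1

/-- Lower bound for the supremum of Rayleigh quotients. -/
theorem lower_sup {n k : ℕ} (A : EuclideanSpace ℝ (Fin n) ≃ₗᵢ[ℝ] EuclideanSpace ℝ (Fin n))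
    (b : EuclideanSpace ℝ (Fin n)) (L : Fin n → ℝ) (hL : ∀ i, 0 < L i) (p : Fin n → ℕ)
    (hp : ∀ i, 0 < p i) (s : ℝ) (hs0 : 0 < s) (hs : ∀ i, L i / p i ≤ s) (hk : ∏ i, p i ≤ k)
    (V : Submodule ℝ (EuclideanSpace ℝ (Fin n) → ℝ)) (hVk : Module.finrank ℝ V = k + 1)
    (hV : ∀ f ∈ V, ContDiff ℝ (⊤ : ℕ∞) f)
    (hinj : ∀ f ∈ V, (∀ x ∈ bmap A b '' Set.Icc 0 L, f x = 0) → f = 0) :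
    1 / s ^ 2 ≤ ⨆ f : {f : EuclideanSpace ℝ (Fin n) → ℝ // f ∈ V ∧ f ≠ 0},
      rayl (bmap A b '' Set.Icc 0 L) f.1 := by
  have : FiniteDimensional ℝ V := Module.finite_of_finrank_pos (by omega)
  have hpos : ∀ f ∈ V, f ≠ 0 → 0 < ∫ x in bmap A b '' Set.Icc 0 L, (f x) ^ 2 := by
    intro f hf hf0
    have : ∃ x ∈ bmap A b '' Set.Icc 0 L, f x ≠ 0 := by
      by_contra! h
      exact hf0 (hinj f hf h)
    obtain ⟨x, hx, hfx⟩ := this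
    exact den_pos A b (hV f hf).continuous L hL hx hfx
  obtain ⟨M, hM⟩ := rayl_bdd _ (isCompact_Icc.image (bmap_continuous A b)) V hV hpos
  have hcont : ∀ f ∈ V, Continuous fun y => f (bmap A b y) := fun f hf =>
    (hV f hf).continuous.comp (bmap_continuous A b)
  let Ψ : V →ₗ[ℝ] (((i : Fin n) → Fin (p i)) → ℝ) :=
    { toFun := fun f j => ∫ y in gcell L p j, f.1 (bmap A b y)
      map_add' := by
        intro f g
        ext j
        exact integral_add (obox_integrable _ _ (hcont f.1 f.2))
          (obox_integrable _ _ (hcont g.1 g.2))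
      map_smul' := by
        intro c f
        ext j
        exact integral_const_mul _ _ }
  have hker : Ψ.ker ≠ ⊥ := by
    apply LinearMap.ker_ne_bot_of_finrank_lt
    rw [hVk, Module.finrank_fintype_fun_eq_card, Fintype.card_pi]
    simp only [Fintype.card_fin]
    omega
  obtain ⟨f, hf, hf0⟩ := (Submodule.ne_bot_iff _).1 hker
  have hf0' : f.1 ≠ 0 := fun h => hf0 (Subtype.ext h)
  have h0 : ∀ j, ∫ y in gcell L p j, f.1 (bmap A b y) = 0 := fun j =>
    congrFun (LinearMap.mem_ker.1 hf) j
  have hP := grid_poincare L hL p hp s hs (fun y => f.1 (bmap A b y)) (pdir A b f.1)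
    (hcont f.1 f.2) (pdir_continuous A b (hV f.1 f.2)) (bmap_hasDerivAt A b (hV f.1 f.2)) h0
  have hr : 1 / s ^ 2 ≤ rayl (bmap A b '' Set.Icc 0 L) f.1 := by
    unfold rayl
    rw [le_div_iff₀ (hpos f.1 f.2 hf0'), num_eq A b (hV f.1 f.2), bmap_integral, one_div,
      inv_mul_le_iff₀ (by positivity)]
    exact hP
  refine hr.trans (le_ciSup (f := fun f : {f : EuclideanSpace ℝ (Fin n) → ℝ // f ∈ V ∧ f ≠ 0} =>
    rayl (bmap A b '' Set.Icc 0 L) f.1) ⟨M, ?_⟩ ⟨f.1, f.2, hf0'⟩)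
  rintro _ ⟨⟨g, hg, hg0⟩, rfl⟩
  exact hM g hg hg0

lemma cos_K {L : ℝ} (hL : 0 < L) (m p : ℕ) :
    ∫ x in Set.Ioc 0 L, (-(Real.sin (m * Real.pi / L * x) * (m * Real.pi / L))) *
        (-(Real.sin (p * Real.pi / L * x) * (p * Real.pi / L))) =
      (m * Real.pi / L) ^ 2 *
        ∫ x in Set.Ioc 0 L, Real.cos (m * Real.pi / L * x) * Real.cos (p * Real.pi / L * x) := by
  have hm : m * Real.pi / L * L = m * Real.pi := by field_simp
  set κ := m * Real.pi / L with hκ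
  set κ' := p * Real.pi / L with hκ'
  have h := intervalIntegral.integral_mul_deriv_eq_deriv_mul (a := 0) (b := L)
    (u := fun x => -(Real.sin (κ * x) * κ)) (u' := fun x => -(Real.cos (κ * x) * κ * κ))
    (v := fun x => Real.cos (κ' * x)) (v' := fun x => -(Real.sin (κ' * x) * κ'))
    (fun x _ => by
      have := (((hasDerivAt_id x).const_mul κ).sin.mul_const κ).neg
      simp only [id, mul_one] at this
      exact this)
    (fun x _ => by
      have := ((hasDerivAt_id x).const_mul κ').cos
      simpa using this)
    (Continuous.intervalIntegrable (by fun_prop) _ _)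
    (Continuous.intervalIntegrable (by fun_prop) _ _)
  rw [intervalIntegral.integral_of_le hL.le, intervalIntegral.integral_of_le hL.le] at h
  rw [h, ← integral_const_mul, hm, Real.sin_nat_mul_pi]
  simp only [mul_zero, Real.sin_zero, zero_mul, neg_zero, sub_zero, zero_sub]
  rw [← integral_neg]
  congr 1
  ext x
  ring

lemma cos_J {L : ℝ} (hL : 0 < L) {m p : ℕ} (hmp : m ≠ p) :
    ∫ x in Set.Ioc 0 L, Real.cos (m * Real.pi / L * x) * Real.cos (p * Real.pi / L * x) = 0 := by
  have h1 := cos_K hL m p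
  have h2 := cos_K hL p m
  simp_rw [mul_comm (-(Real.sin (p * Real.pi / L * _) * (p * Real.pi / L))),
    mul_comm (Real.cos (p * Real.pi / L * _))] at h2
  rw [h1] at h2
  have h3 : ((m * Real.pi / L) ^ 2 - (p * Real.pi / L) ^ 2) *
    ∫ x in Set.Ioc 0 L, Real.cos (m * Real.pi / L * x) * Real.cos (p * Real.pi / L * x) = 0 := by
    rw [sub_mul, h2, sub_self]
  rcases mul_eq_zero.1 h3 with h | h
  · exfalso
    apply hmp
    have hpi := Real.pi_pos
    have h4 : (m * Real.pi / L) = (p * Real.pi / L) :=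
      (sq_eq_sq₀ (by positivity) (by positivity)).1 (sub_eq_zero.1 h)
    have h5 : (m : ℝ) = p := by
      field_simp at h4
      exact h4
    exact_mod_cast h5
  · exact h

lemma cos_pos {L : ℝ} (hL : 0 < L) (m : ℕ) :
    0 < ∫ x in Set.Ioc 0 L, Real.cos (m * Real.pi / L * x) * Real.cos (m * Real.pi / L * x) := by
  rw [← intervalIntegral.integral_of_le hL.le]
  refine intervalIntegral.integral_pos hL (by fun_prop) (fun x _ => mul_self_nonneg _)
    ⟨0, ⟨le_rfl, hL.le⟩, by simp⟩

lemma obox_integral_prod {n : ℕ} (L : Fin n → ℝ) (e : Fin n → ℝ → ℝ) :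
    ∫ y in obox 0 L, ∏ i, e i (y i) = ∏ i, ∫ t in Set.Ioc 0 (L i), e i t := by
  have h := Measure.restrict_pi_pi (fun _ : Fin n => (volume : Measure ℝ))
    (fun i => Set.Ioc 0 (L i))
  unfold obox
  simp only [Pi.zero_apply]
  rw [volume_pi, h]
  exact integral_fintype_prod_eq_prod e

section test
variable {n : ℕ} (A : EuclideanSpace ℝ (Fin n) ≃ₗᵢ[ℝ] EuclideanSpace ℝ (Fin n))
    (b : EuclideanSpace ℝ (Fin n)) (L : Fin n → ℝ)

/-- Cosine test functions. -/
noncomputable def tfun (m : Fin n → ℕ) (x : EuclideanSpace ℝ (Fin n)) : ℝ :=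
  ∏ i, Real.cos (m i * Real.pi / L i * (A.symm (x - b)) i)

lemma tfun_contDiff (m : Fin n → ℕ) : ContDiff ℝ (⊤ : ℕ∞) (tfun A b L m) := by
  unfold tfun
  refine contDiff_prod fun i _ => Real.contDiff_cos.comp (contDiff_const.mul ?_)
  have h1 : ContDiff ℝ (⊤ : ℕ∞) fun x => A.symm (x - b) :=
    A.symm.contDiff.comp (contDiff_id.sub contDiff_const)
  exact (contDiff_euclidean.1 h1) i

lemma tfun_bmap (m : Fin n → ℕ) (y : Fin n → ℝ) :
    tfun A b L m (bmap A b y) = ∏ i, Real.cos (m i * Real.pi / L i * y i) := by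
  simp [tfun, bmap]

lemma tfun_pdir (m : Fin n → ℕ) (i : Fin n) (y : Fin n → ℝ) :
    pdir A b (tfun A b L m) i y = ∏ j, if j = i then
      -(Real.sin (m j * Real.pi / L j * y j) * (m j * Real.pi / L j))
      else Real.cos (m j * Real.pi / L j * y j) := by
  have h1 := bmap_hasDerivAt A b (tfun_contDiff A b L m) i y
  refine h1.unique ?_
  have e : ∀ τ, tfun A b L m (bmap A b (Function.update y i τ)) =
      Real.cos (m i * Real.pi / L i * τ) *
        ∏ j ∈ Finset.univ.erase i, Real.cos (m j * Real.pi / L j * y j) := by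
    intro τ
    rw [tfun_bmap, ← Finset.mul_prod_erase _ _ (Finset.mem_univ i)]
    congr 1
    · simp
    · refine Finset.prod_congr rfl fun j hj => ?_
      rw [Function.update_of_ne (Finset.ne_of_mem_erase hj)]
  simp_rw [e]
  rw [← Finset.mul_prod_erase _ _ (Finset.mem_univ i), if_pos rfl]
  have e2 : (∏ j ∈ Finset.univ.erase i, if j = i then
      -(Real.sin (m j * Real.pi / L j * y j) * (m j * Real.pi / L j))
      else Real.cos (m j * Real.pi / L j * y j)) =
      ∏ j ∈ Finset.univ.erase i, Real.cos (m j * Real.pi / L j * y j) :=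
    Finset.prod_congr rfl fun j hj => if_neg (Finset.ne_of_mem_erase hj)
  rw [e2]
  refine HasDerivAt.mul_const ?_ _
  have := ((hasDerivAt_id (y i)).const_mul (m i * Real.pi / L i)).cos
  simpa using this

/-- Inner products of the test functions. -/
noncomputable def tJ (m p : Fin n → ℕ) : ℝ :=
  ∫ y in obox 0 L, tfun A b L m (bmap A b y) * tfun A b L p (bmap A b y)

lemma tJ_eq (m p : Fin n → ℕ) : tJ A b L m p = ∏ i, ∫ t in Set.Ioc 0 (L i),
    Real.cos (m i * Real.pi / L i * t) * Real.cos (p i * Real.pi / L i * t) := by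
  unfold tJ
  simp_rw [tfun_bmap, ← Finset.prod_mul_distrib]
  exact obox_integral_prod L
    (fun i t => Real.cos (m i * Real.pi / L i * t) * Real.cos (p i * Real.pi / L i * t))

lemma tJ_ne (hL : ∀ i, 0 < L i) {m p : Fin n → ℕ} (h : m ≠ p) : tJ A b L m p = 0 := by
  obtain ⟨i, hi⟩ := Function.ne_iff.1 h
  rw [tJ_eq]
  exact Finset.prod_eq_zero (Finset.mem_univ i) (cos_J (hL i) hi)

lemma tJ_pos (hL : ∀ i, 0 < L i) (m : Fin n → ℕ) : 0 < tJ A b L m m := by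
  rw [tJ_eq]
  exact Finset.prod_pos fun i _ => cos_pos (hL i) _

lemma tK_eq (hL : ∀ i, 0 < L i) (m p : Fin n → ℕ) (i : Fin n) :
    ∫ y in obox 0 L, pdir A b (tfun A b L m) i y * pdir A b (tfun A b L p) i y =
      (m i * Real.pi / L i) ^ 2 * tJ A b L m p := by
  rw [tJ_eq]
  simp_rw [tfun_pdir, ← Finset.prod_mul_distrib]
  rw [obox_integral_prod L (fun j t => (if j = i then
      -(Real.sin (m j * Real.pi / L j * t) * (m j * Real.pi / L j))
      else Real.cos (m j * Real.pi / L j * t)) * (if j = i then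
      -(Real.sin (p j * Real.pi / L j * t) * (p j * Real.pi / L j))
      else Real.cos (p j * Real.pi / L j * t)))]
  rw [← Finset.mul_prod_erase _ _ (Finset.mem_univ i),
    ← Finset.mul_prod_erase Finset.univ (fun i => ∫ t in Set.Ioc 0 (L i),
    Real.cos (m i * Real.pi / L i * t) * Real.cos (p i * Real.pi / L i * t)) (Finset.mem_univ i)]
  simp only [if_true]
  rw [cos_K (hL i), mul_assoc]
  congr 2
  refine Finset.prod_congr rfl fun j hj => ?_
  simp only [if_neg (Finset.ne_of_mem_erase hj)]

lemma quad_expand {ι : Type*} [Fintype ι] (c : ι → ℝ) (u : ι → (Fin n → ℝ) → ℝ)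
    (hu : ∀ m, Continuous (u m)) :
    ∫ y in obox 0 L, (∑ m, c m * u m y) ^ 2 =
      ∑ m, ∑ p, c m * c p * ∫ y in obox 0 L, u m y * u p y := by
  have e : ∀ y, (∑ m, c m * u m y) ^ 2 = ∑ m, ∑ p, c m * c p * (u m y * u p y) := by
    intro y
    rw [sq, Finset.sum_mul_sum]
    refine Finset.sum_congr rfl fun m _ => Finset.sum_congr rfl fun p _ => by ring
  simp_rw [e]
  rw [integral_finsetSum _ fun m _ => obox_integrable _ _ (by fun_prop)]
  refine Finset.sum_congr rfl fun m _ => ?_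
  rw [integral_finsetSum _ fun m _ => obox_integrable _ _ (by fun_prop)]
  exact Finset.sum_congr rfl fun p _ => integral_const_mul _ _

lemma comb_den (hL : ∀ i, 0 < L i) {S : Finset (Fin n → ℕ)} (c : S → ℝ) :
    ∫ x in bmap A b '' Set.Icc 0 L, ((∑ m, c m • tfun A b L m.1) x) ^ 2 =
      ∑ m, c m ^ 2 * tJ A b L m.1 m.1 := by
  rw [bmap_integral]
  simp only [Finset.sum_apply, Pi.smul_apply, smul_eq_mul]
  rw [quad_expand L c (fun m y => tfun A b L m.1 (bmap A b y))
    fun m => (tfun_contDiff A b L m.1).continuous.comp (bmap_continuous A b)]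
  refine Finset.sum_congr rfl fun m _ => ?_
  rw [Finset.sum_eq_single m]
  · rw [sq]; rfl
  · intro p _ hp
    have := tJ_ne A b L hL (m := m.1) (p := p.1) fun h => hp (Subtype.ext h.symm)
    unfold tJ at this
    rw [this, mul_zero]
  · simp

lemma comb_num (hL : ∀ i, 0 < L i) {S : Finset (Fin n → ℕ)} (c : S → ℝ) :
    ∫ x in bmap A b '' Set.Icc 0 L, ‖fderiv ℝ (∑ m, c m • tfun A b L m.1) x‖ ^ 2 =
      ∑ m, (∑ i, (m.1 i * Real.pi / L i) ^ 2) * (c m ^ 2 * tJ A b L m.1 m.1) := by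
  have hsm : ContDiff ℝ (⊤ : ℕ∞) (∑ m, c m • tfun A b L m.1) := by
    have : (∑ m, c m • tfun A b L m.1) = fun x => ∑ m, c m • tfun A b L m.1 x := by
      ext x; simp
    rw [this]
    exact ContDiff.sum fun m _ => (tfun_contDiff A b L m.1).const_smul (c m)
  rw [num_eq A b hsm]
  have e : ∀ i y, pdir A b (∑ m, c m • tfun A b L m.1) i y =
      ∑ m, c m * pdir A b (tfun A b L m.1) i y := by
    intro i y
    unfold pdir
    have hd : ∀ m : S, DifferentiableAt ℝ (tfun A b L m.1) (bmap A b y) := fun m =>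
      ((tfun_contDiff A b L m.1).differentiable (by simp)).differentiableAt
    rw [fderiv_sum fun m _ => (hd m).const_smul (c m)]
    simp only [_root_.sum_apply]
    refine Finset.sum_congr rfl fun m _ => ?_
    rw [fderiv_const_smul (hd m)]
    simp
  simp_rw [e, Finset.sum_mul]
  rw [Finset.sum_comm]
  refine Finset.sum_congr rfl fun i _ => ?_
  rw [quad_expand L c (fun m y => pdir A b (tfun A b L m.1) i y)
    fun m => pdir_continuous A b (tfun_contDiff A b L m.1) i]
  refine Finset.sum_congr rfl fun m _ => ?_
  simp_rw [tK_eq A b L hL]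
  rw [Finset.sum_eq_single m]
  · ring
  · intro p _ hp
    rw [tJ_ne A b L hL (m := m.1) (p := p.1) fun h => hp (Subtype.ext h.symm)]
    ring
  · simp

/-- Upper bound via test functions. -/
theorem upper_space (hL : ∀ i, 0 < L i) (l : ℕ)
    (S : Finset (Fin n → ℕ)) (hS : S.card = l + 1) (Λ : ℝ)
    (hΛ : ∀ m ∈ S, ∑ i, (m i * Real.pi / L i) ^ 2 ≤ Λ) :
    ∃ V : Submodule ℝ (EuclideanSpace ℝ (Fin n) → ℝ), (Module.finrank ℝ V = l + 1 ∧
      (∀ f ∈ V, ContDiff ℝ (⊤ : ℕ∞) f) ∧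
      ∀ f ∈ V, (∀ x ∈ bmap A b '' Set.Icc 0 L, f x = 0) → f = 0) ∧
      ∀ f ∈ V, f ≠ 0 → rayl (bmap A b '' Set.Icc 0 L) f ≤ Λ := by
  have key : ∀ c : S → ℝ, (∀ x ∈ bmap A b '' Set.Icc 0 L,
      (∑ m, c m • tfun A b L m.1) x = 0) → ∀ m, c m = 0 := by
    intro c hc
    have h1 := comb_den A b L hL c
    have hm : MeasurableSet (bmap A b '' Set.Icc 0 L) :=
      (isCompact_Icc.image (bmap_continuous A b)).measurableSet
    rw [setIntegral_congr_fun (g := fun _ => (0 : ℝ)) hm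
      (fun x hx => by simp only [hc x hx]; norm_num)] at h1
    simp only [integral_zero] at h1
    have h2 := (Finset.sum_eq_zero_iff_of_nonneg (fun m _ =>
      mul_nonneg (sq_nonneg (c m)) (tJ_pos A b L hL m.1).le)).1 h1.symm
    intro m
    have h3 := h2 m (Finset.mem_univ m)
    rcases mul_eq_zero.1 h3 with h | h
    · exact pow_eq_zero_iff (two_ne_zero) |>.1 h
    · exact absurd h (tJ_pos A b L hL m.1).ne'
  refine ⟨Submodule.span ℝ (Set.range fun m : S => tfun A b L m.1), ⟨?_, ?_, ?_⟩, ?_⟩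
  · rw [finrank_span_eq_card, Fintype.card_coe, hS]
    rw [Fintype.linearIndependent_iff]
    intro c hc
    exact key c fun x _ => by rw [hc]; rfl
  · intro f hf
    obtain ⟨c, rfl⟩ := (Submodule.mem_span_range_iff_exists_fun ℝ).1 hf
    have : (∑ m, c m • tfun A b L m.1) = fun x => ∑ m, c m • tfun A b L m.1 x := by
      ext x; simp
    rw [this]
    exact ContDiff.sum fun m _ => (tfun_contDiff A b L m.1).const_smul (c m)
  · intro f hf h0
    obtain ⟨c, rfl⟩ := (Submodule.mem_span_range_iff_exists_fun ℝ).1 hf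
    have := key c h0
    simp [this]
  · intro f hf hf0
    obtain ⟨c, rfl⟩ := (Submodule.mem_span_range_iff_exists_fun ℝ).1 hf
    unfold rayl
    rw [comb_num A b L hL, comb_den A b L hL]
    have hpos : 0 < ∑ m, c m ^ 2 * tJ A b L m.1 m.1 := by
      obtain ⟨m, hm⟩ : ∃ m, c m ≠ 0 := by
        by_contra! h
        exact hf0 (by simp [h])
      refine Finset.sum_pos' (fun m _ => mul_nonneg (sq_nonneg (c m)) (tJ_pos A b L hL m.1).le)
        ⟨m, Finset.mem_univ m, ?_⟩
      have := tJ_pos A b L hL m.1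
      positivity
    rw [div_le_iff₀ hpos, Finset.mul_sum]
    refine Finset.sum_le_sum fun m _ => mul_le_mul_of_nonneg_right (hΛ m.1 m.2) ?_
    exact mul_nonneg (sq_nonneg (c m)) (tJ_pos A b L hL m.1).le

end test

lemma upper_eig {n l : ℕ} (A : EuclideanSpace ℝ (Fin n) ≃ₗᵢ[ℝ] EuclideanSpace ℝ (Fin n))
    (b : EuclideanSpace ℝ (Fin n)) (L : Fin n → ℝ) (hL : ∀ i, 0 < L i) (r : ℝ) (hr : 0 < r)
    (hl : l + 1 ≤ ∏ i, ⌈L i / r⌉₊) :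
    Nonempty {V : Submodule ℝ (EuclideanSpace ℝ (Fin n) → ℝ) //
      Module.finrank ℝ V = l + 1 ∧ (∀ f ∈ V, ContDiff ℝ (⊤ : ℕ∞) f) ∧
      ∀ f ∈ V, (∀ x ∈ bmap A b '' Set.Icc 0 L, f x = 0) → f = 0} ∧
    neumannEigenvalue n l (bmap A b '' Set.Icc 0 L) ≤ n * (Real.pi / r) ^ 2 := by
  have hpi := Real.pi_pos
  have hcard : l + 1 ≤ (Fintype.piFinset fun i => Finset.range ⌈L i / r⌉₊).card := by
    rw [Fintype.card_piFinset]
    simpa using hl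
  obtain ⟨S, hS, hSc⟩ := Finset.exists_subset_card_eq hcard
  have hΛ : ∀ m ∈ S, ∑ i, (m i * Real.pi / L i) ^ 2 ≤ n * (Real.pi / r) ^ 2 := by
    intro m hm
    have h1 := Fintype.mem_piFinset.1 (hS hm)
    have h2 : ∀ i ∈ Finset.univ, (m i * Real.pi / L i) ^ 2 ≤ (Real.pi / r) ^ 2 := by
      intro i _
      have h3 : (m i : ℝ) < L i / r := Nat.lt_ceil.1 (Finset.mem_range.1 (h1 i))
      have h4 := hL i
      refine pow_le_pow_left₀ (by positivity) ?_ 2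
      rw [lt_div_iff₀ hr] at h3
      rw [div_le_div_iff₀ h4 hr]
      nlinarith
    refine (Finset.sum_le_card_nsmul _ _ _ h2).trans ?_
    simp
  obtain ⟨V, hV, hray⟩ := upper_space A b L hL l S hSc _ hΛ
  refine ⟨⟨V, hV⟩, ?_⟩
  unfold neumannEigenvalue
  refine (ciInf_le ⟨0, ?_⟩ ⟨V, hV⟩).trans ?_
  · rintro _ ⟨W, rfl⟩
    refine Real.iSup_nonneg fun f => div_nonneg ?_ ?_ <;>
      exact integral_nonneg fun x => sq_nonneg _
  · refine Real.iSup_le (fun f => hray f.1 f.2.1 f.2.2) (by positivity)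

lemma lower_eig {n k : ℕ} (A : EuclideanSpace ℝ (Fin n) ≃ₗᵢ[ℝ] EuclideanSpace ℝ (Fin n))
    (b : EuclideanSpace ℝ (Fin n)) (L : Fin n → ℝ) (hL : ∀ i, 0 < L i) (s : ℝ) (hs : 0 < s)
    (hk : ∏ i, ⌈L i / s⌉₊ ≤ k)
    (hne : Nonempty {V : Submodule ℝ (EuclideanSpace ℝ (Fin n) → ℝ) //
      Module.finrank ℝ V = k + 1 ∧ (∀ f ∈ V, ContDiff ℝ (⊤ : ℕ∞) f) ∧
      ∀ f ∈ V, (∀ x ∈ bmap A b '' Set.Icc 0 L, f x = 0) → f = 0}) :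
    1 / s ^ 2 ≤ neumannEigenvalue n k (bmap A b '' Set.Icc 0 L) := by
  unfold neumannEigenvalue
  have hp : ∀ i, 0 < ⌈L i / s⌉₊ := fun i => Nat.ceil_pos.2 (div_pos (hL i) hs)
  refine le_ciInf fun V => lower_sup A b L hL (fun i => ⌈L i / s⌉₊) hp s hs (fun i => ?_) hk V.1
    V.2.1 V.2.2.1 V.2.2.2
  have h1 : (0 : ℝ) < ⌈L i / s⌉₊ := by exact_mod_cast hp i
  have h2 := Nat.le_ceil (L i / s)
  rw [div_le_iff₀ hs] at h2
  rw [div_le_iff₀ h1]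
  linarith

lemma exists_small {n : ℕ} (hn : 1 ≤ n) (L : Fin n → ℝ) (hL : ∀ i, 0 < L i) (B : ℝ) (hB : 0 < B)
    (N : ℕ) : ∃ j : ℕ, N ≤ ∏ i, ⌈L i / (B / 2 ^ j)⌉₊ := by
  have i0 : Fin n := ⟨0, hn⟩
  obtain ⟨j, hj⟩ := pow_unbounded_of_one_lt (N * B / L i0) (one_lt_two)
  refine ⟨j, ?_⟩
  have hp : ∀ i ∈ Finset.univ, 1 ≤ ⌈L i / (B / 2 ^ j)⌉₊ := fun i _ =>
    Nat.ceil_pos.2 (div_pos (hL i) (by positivity))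
  refine le_trans ?_ (Finset.single_le_prod' hp (Finset.mem_univ i0))
  have h0 := hL i0
  have h1 : (N : ℝ) ≤ L i0 / (B / 2 ^ j) := by
    rw [le_div_iff₀ (by positivity), mul_div_assoc', div_le_iff₀ (by positivity)]
    rw [div_lt_iff₀ h0] at hj
    linarith
  exact_mod_cast h1.trans (Nat.le_ceil _)

lemma ceil_scale (n : ℕ) (L : Fin n → ℝ) (r : ℝ) (q : ℕ) (hq : 0 < q) :
    ∏ i, ⌈L i / (r / q)⌉₊ ≤ q ^ n * ∏ i, ⌈L i / r⌉₊ := by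
  have e : q ^ n * ∏ i, ⌈L i / r⌉₊ = ∏ i, (q * ⌈L i / r⌉₊) := by
    rw [Finset.prod_mul_distrib]; simp
  rw [e]
  refine Finset.prod_le_prod' fun i _ => ?_
  rw [Nat.ceil_le]
  push_cast
  rw [div_div_eq_mul_div, mul_comm, mul_div_assoc]
  exact mul_le_mul_of_nonneg_left (Nat.le_ceil _) (by positivity)

/-- There is a universal constant `c > 0` such that for every `n ≥ 1`, every orthotope
`R ⊆ ℝⁿ`, and all integers `k ≥ l ≥ 1`, `μ_k(R) ≥ (1/(c·n³)) · (k/l)^(2/n) · μ_l(R)`. -/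
theorem orthotope_lower_bound :
    ∃ c : ℝ, 0 < c ∧ ∀ n : ℕ, 1 ≤ n →
      ∀ R : Set (EuclideanSpace ℝ (Fin n)), IsOrthotope n R →
        ∀ k l : ℕ, 1 ≤ l → l ≤ k →
          1 / (c * (n : ℝ) ^ 3) * ((k : ℝ) / (l : ℝ)) ^ ((2 : ℝ) / (n : ℝ)) *
              neumannEigenvalue n l R ≤
            neumannEigenvalue n k R := by
  have hpi := Real.pi_pos
  refine ⟨16 * Real.pi ^ 2, by positivity, fun n hn R hR k l hl hlk => ?_⟩
  obtain ⟨A, b, L, hL, rfl⟩ := orthotope_bmap hR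
  have hn0 : (1 : ℝ) ≤ n := by exact_mod_cast hn
  have hl0 : (0 : ℝ) < l := by exact_mod_cast hl
  have hkl : (1 : ℝ) ≤ (k : ℝ) / l := by
    rw [le_div_iff₀ hl0, one_mul]; exact_mod_cast hlk
  set B := ∑ i, L i with hBdef
  have hLB : ∀ i, L i ≤ B := fun i =>
    Finset.single_le_sum (fun i _ => (hL i).le) (Finset.mem_univ i)
  have hB : 0 < B := lt_of_lt_of_le (hL ⟨0, hn⟩) (hLB _)
  -- dyadic choice of the scale
  obtain ⟨r, hr, hr1, hr2⟩ : ∃ r : ℝ, 0 < r ∧ ∏ i, ⌈L i / r⌉₊ ≤ l ∧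
      l + 1 ≤ ∏ i, ⌈L i / (r / 2)⌉₊ := by
    classical
    have hex := exists_small hn L hL B hB (l + 1)
    have hspec := Nat.find_spec hex
    have hmin := fun m => Nat.find_min (m := m) hex
    have hne : Nat.find hex ≠ 0 := by
      intro h0
      rw [h0] at hspec
      have : ∏ i, ⌈L i / (B / 2 ^ 0)⌉₊ ≤ ∏ i : Fin n, 1 := by
        refine Finset.prod_le_prod' fun i _ => ?_
        rw [Nat.ceil_le, pow_zero, div_one, Nat.cast_one]
        exact (div_le_one hB).2 (hLB i)
      simp only [Finset.prod_const_one] at this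
      omega
    obtain ⟨j, hj⟩ := Nat.exists_eq_succ_of_ne_zero hne
    rw [hj] at hspec
    refine ⟨B / 2 ^ j, by positivity, ?_, ?_⟩
    · have := hmin j (by omega)
      omega
    · rw [div_div, ← pow_succ]
      exact hspec
  -- the refinement factor
  set θ : ℝ := ((k : ℝ) / l) ^ ((1 : ℝ) / n) with hθ
  have hθ1 : 1 ≤ θ := Real.one_le_rpow hkl (by positivity)
  set q := ⌊θ⌋₊ with hqdef
  have hq : 0 < q := Nat.floor_pos.2 hθ1
  have hq1 : (1 : ℝ) ≤ q := by exact_mod_cast hq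
  have hqθ : (q : ℝ) ≤ θ := Nat.floor_le (by linarith)
  have hθq : θ ≤ 2 * q := by
    have := Nat.lt_floor_add_one θ
    linarith
  have hθn : θ ^ n = (k : ℝ) / l := by
    rw [hθ, ← Real.rpow_natCast, ← Real.rpow_mul (by positivity), one_div,
      inv_mul_cancel₀ (by positivity), Real.rpow_one]
  have hθ2 : ((k : ℝ) / l) ^ ((2 : ℝ) / n) = θ ^ 2 := by
    rw [hθ, ← Real.rpow_natCast, ← Real.rpow_mul (by positivity)]
    congr 1
    push_cast
    ring
  have hk : ∏ i, ⌈L i / (r / q)⌉₊ ≤ k := by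
    refine (ceil_scale n L r q hq).trans ?_
    have h1 : (q : ℝ) ^ n * l ≤ k := by
      have : (q : ℝ) ^ n ≤ (k : ℝ) / l := hθn ▸ pow_le_pow_left₀ (by positivity) hqθ n
      rwa [le_div_iff₀ hl0] at this
    have h2 : q ^ n * l ≤ k := by exact_mod_cast h1
    exact (Nat.mul_le_mul_left _ hr1).trans h2
  obtain ⟨j, hj⟩ := exists_small hn L hL B hB (k + 1)
  have hne := (upper_eig A b L hL (B / 2 ^ j) (by positivity) hj).1
  have hlow := lower_eig A b L hL (r / q) (by positivity) hk hne
  have hup := (upper_eig A b L hL (r / 2) (by positivity) hr2).2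
  refine le_trans ?_ hlow
  rw [hθ2]
  have hθ4 : θ ^ 2 ≤ (2 * q) ^ 2 := pow_le_pow_left₀ (by linarith) hθq 2
  calc 1 / (16 * Real.pi ^ 2 * (n : ℝ) ^ 3) * θ ^ 2 *
        neumannEigenvalue n l (bmap A b '' Set.Icc 0 L)
      ≤ 1 / (16 * Real.pi ^ 2 * (n : ℝ) ^ 3) * θ ^ 2 * (n * (Real.pi / (r / 2)) ^ 2) :=
        mul_le_mul_of_nonneg_left hup (by positivity)
    _ ≤ 1 / (16 * Real.pi ^ 2 * (n : ℝ) ^ 3) * (2 * q) ^ 2 * (n * (Real.pi / (r / 2)) ^ 2) :=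
        mul_le_mul_of_nonneg_right (mul_le_mul_of_nonneg_left hθ4 (by positivity)) (by positivity)
    _ = 1 / (n : ℝ) ^ 2 * (1 / (r / q) ^ 2) := by
        field_simp
        ring
    _ ≤ 1 * (1 / (r / q) ^ 2) := by
        refine mul_le_mul_of_nonneg_right ?_ (by positivity)
        rw [div_le_one (by positivity)]
        exact one_le_pow₀ hn0
    _ = 1 / (r / q) ^ 2 := one_mul _
end
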